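/- Let T be a complete stable first-order L-theory and suppose T_aut has a model completion T^mc_aut. Then the following are equivalent: (a) every completion of T^mc_aut is stable; (c) every completion of T^mc_aut is dependent, i.e., no L⁺-formula has the independence property with respect to it. -/

import Mathlib

namespace FirstOrder

open Language Structure

universe u v w

namespace ShelahE34

/-- The index type for the function symbols of the language consisting of a single
unary function symbol `σ`. -/
inductive SigmaFunc : ℕ → Type
  | sigma : SigmaFunc 1

/-- The language consisting of a single unary function symbol `σ`. -/
def sigmaLang : Language.{0, 0} :=
  ⟨SigmaFunc, fun _ => Empty⟩

/-- `L⁺`: the language `L` expanded by one new unary function symbol `σ`. -/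
abbrev LPlus (L : Language.{u, v}) : Language :=
  L.sum sigmaLang

/-- The new unary function symbol `σ` of `L⁺`. -/
def sigmaSymb (L : Language.{u, v}) : (LPlus L).Functions 1 :=
  Sum.inr SigmaFunc.sigma

/-- Application of the symbol `σ` to a term of `L⁺`. -/
def sigmaTerm {L : Language.{u, v}} {α : Type w} (t : (LPlus L).Term α) : (LPlus L).Term α :=
  Functions.apply₁ (sigmaSymb L) t

/-- The interpretation of the symbol `σ` in an `L⁺`-structure, as a function. -/
def sigmaMap (L : Language.{u, v}) (N : Type w) [(LPlus L).Structure N] : N → N :=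
  fun x => funMap (sigmaSymb L) ![x]

/-- The sentence `(∀x)(∀y)(σ(x) = σ(y) → x = y)`. -/
def sigmaInj (L : Language.{u, v}) : (LPlus L).Sentence :=
  ∀' ∀' ((sigmaTerm (&0) =' sigmaTerm (&1)) ⟹ ((&0) =' (&1)))

/-- The sentence `(∀y)(∃x)(σ(x) = y)`. -/
def sigmaSurj (L : Language.{u, v}) : (LPlus L).Sentence :=
  ∀' ∃' (sigmaTerm (&1) =' (&0))

/-- The sentence `(∀x̄)(F(σ(x̄)) = σ(F(x̄)))` for a function symbol `F` of `L`. -/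
def funCommSentence (L : Language.{u, v}) {n : ℕ} (F : L.Functions n) : (LPlus L).Sentence :=
  BoundedFormula.alls
    (sigmaTerm (Term.func (Sum.inl F : (LPlus L).Functions n) fun i => Term.var (Sum.inr i)) ='
      Term.func (Sum.inl F : (LPlus L).Functions n) fun i => sigmaTerm (Term.var (Sum.inr i)))

/-- The sentence `(∀x̄)(R(x̄) ↔ R(σ(x̄)))` for a relation symbol `R` of `L`. -/
def relPresSentence (L : Language.{u, v}) {n : ℕ} (R : L.Relations n) : (LPlus L).Sentence :=
  BoundedFormula.alls
    ((Relations.boundedFormula (Sum.inl R : (LPlus L).Relations n)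
        fun i => Term.var (Sum.inr i)) ⇔
      Relations.boundedFormula (Sum.inl R : (LPlus L).Relations n)
        fun i => sigmaTerm (Term.var (Sum.inr i)))

/-- `T_aut`: the `L⁺`-theory consisting of `T` together with the sentences asserting that `σ`
is an automorphism. -/
def Taut {L : Language.{u, v}} (T : L.Theory) : (LPlus L).Theory :=
  (LHom.sumInl : L →ᴸ LPlus L).onTheory T ∪ {sigmaInj L, sigmaSurj L} ∪
    {φ | ∃ (n : ℕ) (F : L.Functions n), φ = funCommSentence L F} ∪
    {φ | ∃ (n : ℕ) (R : L.Relations n), φ = relPresSentence L R}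

/-- A theory is complete and consistent if it is satisfiable and semantically decides every
sentence. -/
def SemComplete {L' : Language.{u, v}} (U : L'.Theory) : Prop :=
  U.IsSatisfiable ∧ ∀ φ : L'.Sentence, U ⊨ᵇ φ ∨ U ⊨ᵇ ∼φ

/-- A completion of a theory `S`: a complete consistent theory in the same language
containing `S`. -/
def IsCompletionOf {L' : Language.{u, v}} (S U : L'.Theory) : Prop :=
  S ⊆ U ∧ SemComplete U

/-- The atomic diagram of a structure `M`: all atomic and negated atomic sentences with
constants from `M` that hold in `M`. -/
def atomicDiagram (L' : Language.{u, v}) (M : Type w) [L'.Structure M] : (L'[[M]]).Theory :=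
  {φ | (φ.IsAtomic ∨ ∃ ψ : (L'[[M]]).Sentence, ψ.IsAtomic ∧ φ = ∼ψ) ∧ M ⊨ φ}

/-- `Tstar` is a model completion of `S`: it contains `S`, every model of `S` embeds into a
model of `Tstar`, and for every model `M` of `S`, `Tstar` together with the atomic diagram of
`M` is a complete consistent theory. -/
def IsModelCompletion.{u', v', w'} {L' : Language.{u', v'}} (S Tstar : L'.Theory) : Prop :=
  S ⊆ Tstar ∧
    (∀ M : Theory.ModelType.{u', v', w'} S, ∃ N : Theory.ModelType.{u', v', w'} Tstar,
      Nonempty (M ↪[L'] N)) ∧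
    ∀ M : Theory.ModelType.{u', v', w'} S,
      SemComplete ((L'.lhomWithConstants M).onTheory Tstar ∪ atomicDiagram L' M)

/-- A formula has the order property with respect to a theory `S` if in some model of `S`
there are tuples `(ā_i)` and `(b̄_j)` such that `φ(ā_i, b̄_j)` holds iff `i < j`. -/
def HasOrderProperty.{u', v', w'} {L' : Language.{u', v'}} (S : L'.Theory) : Prop :=
  ∃ (nx ny : ℕ) (φ : L'.Formula (Fin nx ⊕ Fin ny)) (N : Theory.ModelType.{u', v', w'} S)
    (a : ℕ → Fin nx → N) (b : ℕ → Fin ny → N),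
    ∀ i j : ℕ, φ.Realize (Sum.elim (a i) (b j)) ↔ i < j

/-- A theory is stable if no formula has the order property with respect to it. -/
def IsStableTheory.{u', v', w'} {L' : Language.{u', v'}} (S : L'.Theory) : Prop :=
  ¬ HasOrderProperty.{u', v', w'} S

/-- A formula has the independence property with respect to a theory `S` if in some model of
`S` there are tuples `(ā_i)` such that every finite `w ⊆ ℕ` is cut out by some `b̄_w`. -/
def HasIndependenceProperty.{u', v', w'} {L' : Language.{u', v'}} (S : L'.Theory) : Prop :=
  ∃ (nx ny : ℕ) (φ : L'.Formula (Fin nx ⊕ Fin ny)) (N : Theory.ModelType.{u', v', w'} S)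
    (a : ℕ → Fin nx → N),
    ∀ s : Finset ℕ, ∃ b : Fin ny → N, ∀ i : ℕ, φ.Realize (Sum.elim (a i) b) ↔ i ∈ s

/-- A theory is dependent (NIP) if no formula has the independence property with respect
to it. -/
def IsDependentTheory.{u', v', w'} {L' : Language.{u', v'}} (S : L'.Theory) : Prop :=
  ¬ HasIndependenceProperty.{u', v', w'} S


section PartA

open scoped Pointwise
open Filter

/-- `R` has no infinite ladder. -/
def NL {I : Type*} {J : Type*} (R : I → J → Prop) : Prop :=
  ¬ ∃ (i : ℕ → I) (j : ℕ → J), ∀ m n, R (i m) (j n) ↔ m < n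

theorem NL.comp {I J I' J' : Type*} {R : I → J → Prop} (h : NL R) (f : I' → I) (g : J' → J) :
    NL (fun i j => R (f i) (g j)) := by
  rintro ⟨i, j, hij⟩
  exact h ⟨fun m => f (i m), fun n => g (j n), hij⟩

theorem NL.not_le {I J : Type*} {R : I → J → Prop} (h : NL R) (i : ℕ → I) (j : ℕ → J) :
    ¬ ∀ m n, R (i m) (j n) ↔ m ≤ n := by
  intro H
  exact h ⟨fun m => i (m + 1), j, fun m n => by rw [H]; omega⟩

theorem lim_comm {I J : Type*} {R : I → J → Prop} (h : NL R) (U : Ultrafilter I)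
    (V : Ultrafilter J) (H : ∀ᶠ i in (U : Filter I), ∀ᶠ j in (V : Filter J), R i j) :
    ∀ᶠ j in (V : Filter J), ∀ᶠ i in (U : Filter I), R i j := by
  by_contra hcon
  rw [← Ultrafilter.eventually_not] at hcon
  obtain ⟨f, hf, hr⟩ := exists_seq_of_forall_finset_exists
    (fun p : I × J => (∀ᶠ j in (V : Filter J), R p.1 j) ∧ (¬ ∀ᶠ i in (U : Filter I), R i p.2) ∧
      R p.1 p.2) (fun p q => R p.1 q.2 ∧ ¬ R q.1 p.2) (by
      intro s hs
      have h1 : ∀ᶠ i in (U : Filter I), ∀ p ∈ s, ¬ R i p.2 := by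
        rw [Filter.eventually_all_finset]
        intro p hp
        exact Ultrafilter.eventually_not.2 (hs p hp).2.1
      have h2 : ∀ᶠ j in (V : Filter J), ∀ p ∈ s, R p.1 j := by
        rw [Filter.eventually_all_finset]
        intro p hp
        exact (hs p hp).1
      obtain ⟨i, hi1, hi2⟩ := (H.and h1).exists
      obtain ⟨j, hj1, hj2, hj3⟩ := (hcon.and (h2.and hi1)).exists
      exact ⟨(i, j), ⟨hi1, hj1, hj3⟩, fun p hp => ⟨hj2 p hp, hi2 p hp⟩⟩)
  refine h.not_le (fun m => (f m).1) (fun n => (f n).2) ?_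
  intro m n
  rcases lt_trichotomy m n with hmn | hmn | hmn
  · simp [hmn.le, (hr m n hmn).1]
  · subst hmn; simp [(hf m).2.2]
  · simp [not_le.2 hmn, (hr n m hmn).2]

theorem lim_comm_iff {I J : Type*} {R : I → J → Prop} (h : NL R) (h' : NL (fun j i => R i j))
    (U : Ultrafilter I) (V : Ultrafilter J) :
    (∀ᶠ i in (U : Filter I), ∀ᶠ j in (V : Filter J), R i j) ↔
    ∀ᶠ j in (V : Filter J), ∀ᶠ i in (U : Filter I), R i j :=
  ⟨lim_comm h U V, lim_comm h' V U⟩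

/-- Functions to a finite type are eventually constant along an ultrafilter. -/
theorem ev_const {I β : Type*} [Finite β] (U : Ultrafilter I) (f : I → β) :
    ∃ c, ∀ᶠ i in (U : Filter I), f i = c := by
  obtain ⟨c, hc⟩ := Ultrafilter.eq_pure_of_finite (U.map f)
  refine ⟨c, ?_⟩
  have : {c} ∈ U.map f := by rw [hc]; exact Ultrafilter.mem_pure.2 rfl
  exact this

/-- product of ultrafilters -/
def prodU {I J : Type*} (U : Ultrafilter I) (V : Ultrafilter J) : Ultrafilter (I × J) :=
  U.bind (fun i => V.map (fun j => (i, j)))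

theorem ev_bind {I J : Type*} (U : Ultrafilter I) (V : I → Ultrafilter J) (p : J → Prop) :
    (∀ᶠ q in (U.bind V : Filter J), p q) ↔
      ∀ᶠ i in (U : Filter I), ∀ᶠ j in (V i : Filter J), p j := Iff.rfl

theorem ev_prodU {I J : Type*} (U : Ultrafilter I) (V : Ultrafilter J) (p : I × J → Prop) :
    (∀ᶠ q in (prodU U V : Filter (I × J)), p q) ↔
      ∀ᶠ i in (U : Filter I), ∀ᶠ j in (V : Filter J), p (i, j) := Iff.rfl

section Flow

variable {H A Z : Type*} [Group H] [MulAction H A] [MulAction H Z]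

/-- The definable set cut out by an ultrafilter. -/
def DD (R : A → Z → Prop) (z0 : Z) (x : Ultrafilter H) : Set A :=
  {u | ∀ᶠ l in (x : Filter H), R u (l • z0)}

theorem iso_lemma {R : A → Z → Prop} (z0 : Z)
    (hst : NL (fun (p : A × A) v => R p.1 v ∧ ¬ R p.2 v))
    (X : Set (Ultrafilter H)) (hX : X.Nonempty) :
    ∃ s : Set H, (X ∩ {x | s ∈ x}).Nonempty ∧ (DD R z0 '' (X ∩ {x | s ∈ x})).Finite := by
  classical
  by_contra hcon
  push Not at hcon
  let ψ : A × A → H → Prop := fun p h => R p.1 (h • z0) ∧ ¬ R p.2 (h • z0)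
  let cell : Finset (A × A) → Set (Ultrafilter H) :=
    fun F => X ∩ {x | {l : H | ∀ p ∈ F, ψ p l} ∈ x}
  have step : ∀ q : {F : Finset (A × A) // (cell F).Nonempty} × Finset H,
      ∃ ph : (A × A) × H, (cell (insert ph.1 q.1.1)).Nonempty ∧ (∀ g ∈ q.2, ¬ ψ ph.1 g) ∧
        ∀ p ∈ insert ph.1 q.1.1, ψ p ph.2 := by
    rintro ⟨⟨F, hF⟩, G⟩
    have hinf := hcon _ hF
    have key : ∃ x ∈ cell F, ∃ p : A × A, p.1 ∈ DD R z0 x ∧ p.2 ∉ DD R z0 x ∧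
        ∀ g ∈ G, ¬ ψ p g := by
      by_contra hk
      push Not at hk
      apply hinf
      let t : A → Finset H := fun a => G.filter (fun g => R a (g • z0))
      refine Set.Finite.subset
        (((Finset.finite_toSet G.powerset).powerset).image (fun 𝒮 : Set (Finset H) => t ⁻¹' 𝒮)) ?_
      rintro _ ⟨x, hx, rfl⟩
      refine ⟨t '' (DD R z0 x), ?_, ?_⟩
      · rintro _ ⟨a, -, rfl⟩
        exact Finset.mem_coe.2 (Finset.mem_powerset.2 (Finset.filter_subset _ _))
      · ext a'
        constructor
        · rintro ⟨a, ha, hta⟩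
          by_contra ha'
          obtain ⟨g, hg, hψ⟩ := hk x hx (a, a') ha ha'
          have : g ∈ t a := by simp [t, hg, hψ.1]
          rw [hta] at this
          exact hψ.2 (by simpa [t, hg] using this)
        · intro ha
          exact ⟨a', ha, rfl⟩
    obtain ⟨x, hx, p, hp1, hp2, hpG⟩ := key
    have hmem : {l : H | ∀ p' ∈ insert p F, ψ p' l} ∈ x := by
      have h1 : ∀ᶠ l in (x : Filter H), R p.1 (l • z0) := hp1
      have h2 : ∀ᶠ l in (x : Filter H), ¬ R p.2 (l • z0) := Ultrafilter.eventually_not.2 hp2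
      have h3 : ∀ᶠ l in (x : Filter H), ∀ p ∈ F, ψ p l := hx.2
      filter_upwards [h1, h2, h3] with l a1 a2 a3
      intro p' hp'
      rcases Finset.mem_insert.1 hp' with rfl | h
      · exact ⟨a1, a2⟩
      · exact a3 p' h
    obtain ⟨h, hh⟩ := Ultrafilter.nonempty_of_mem hmem
    exact ⟨(p, h), ⟨x, hx.1, hmem⟩, hpG, hh⟩
  choose nxt h1 h2 h3 using step
  have h0 : (cell ∅).Nonempty := by
    obtain ⟨x, hx⟩ := hX
    exact ⟨x, hx, Filter.Eventually.of_forall (f := (x : Filter H)) (by simp)⟩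
  let st : ℕ → {F : Finset (A × A) // (cell F).Nonempty} × Finset H := fun n =>
    Nat.rec (⟨∅, h0⟩, ∅) (fun _ q => (⟨insert (nxt q).1 q.1.1, h1 q⟩, insert (nxt q).2 q.2)) n
  have stsucc : ∀ n, st (n + 1) = (⟨insert (nxt (st n)).1 (st n).1.1, h1 (st n)⟩,
    insert (nxt (st n)).2 (st n).2) := fun n => rfl
  have m1 : Monotone (fun n => (st n).1.1) := by
    refine monotone_nat_of_le_succ (fun n => ?_)
    rw [stsucc]; exact Finset.subset_insert _ _
  have m2 : Monotone (fun n => (st n).2) := by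
    refine monotone_nat_of_le_succ (fun n => ?_)
    rw [stsucc]; exact Finset.subset_insert _ _
  refine hst.not_le (fun n => (nxt (st n)).1) (fun n => (nxt (st n)).2 • z0) ?_
  intro m n
  change ψ _ _ ↔ _
  constructor
  · intro hψ
    by_contra hlt
    push Not at hlt
    refine h2 (st m) (nxt (st n)).2 (m2 (Nat.succ_le_of_lt hlt) ?_) hψ
    change _ ∈ (st (n + 1)).2
    rw [stsucc]; exact Finset.mem_insert_self _ _
  · intro hle
    apply h3 (st n)
    have : (nxt (st m)).1 ∈ (st (m + 1)).1.1 := by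
      rw [stsucc]; exact Finset.mem_insert_self _ _
    have h4 := m1 (Nat.succ_le_succ hle) this
    change _ ∈ (st (n + 1)).1.1 at h4
    rw [stsucc] at h4
    exact h4

theorem DD_map {R : A → Z → Prop} {z0 : Z} (hinv : ∀ (h : H) u v, R (h • u) (h • v) ↔ R u v)
    (x : Ultrafilter H) (h : H) : DD R z0 (x.map (h * ·)) = h • DD R z0 x := by
  ext u
  rw [Set.mem_smul_set_iff_inv_smul_mem]
  change (∀ᶠ l in (x : Filter H), R u ((h * l) • z0)) ↔ ∀ᶠ l in (x : Filter H), R _ _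
  refine Filter.eventually_congr (Filter.Eventually.of_forall fun l => ?_)
  rw [← hinv h (h⁻¹ • u), smul_inv_smul, mul_smul]

theorem exists_FO {Θ : Type*} {R : Θ → A → Z → Prop} (z0 : Z)
    (hst : ∀ t, NL (fun (p : A × A) v => R t p.1 v ∧ ¬ R t p.2 v))
    (hinv : ∀ t (h : H) u v, R t (h • u) (h • v) ↔ R t u v) :
    ∃ x : Ultrafilter H, ∀ t, (MulAction.orbit H (DD (R t) z0 x)).Finite := by
  classical
  let S : Set (Set (Ultrafilter H)) :=
    {X | IsClosed X ∧ X.Nonempty ∧ ∀ (h : H), ∀ x ∈ X, x.map (h * ·) ∈ X}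
  obtain ⟨X, -, hX⟩ := zorn_superset_nonempty S (by
    intro c hc hchain hne
    refine ⟨⋂₀ c, ⟨isClosed_sInter fun s hs => (hc hs).1, ?_, ?_⟩, fun s hs => Set.sInter_subset_of_mem hs⟩
    · refine IsCompact.nonempty_sInter_of_directed_nonempty_isCompact_isClosed (S := c) (hS := hne.to_subtype) ?_ ?_ ?_ ?_
      · exact IsChain.directedOn (r := fun a b : Set (Ultrafilter H) => b ⊆ a) hchain.symm
      · exact fun s hs => (hc hs).2.1
      · exact fun s hs => (hc hs).1.isCompact
      · exact fun s hs => (hc hs).1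
    · intro h x hx s hs
      exact (hc hs).2.2 h x (hx s hs)) Set.univ
    ⟨isClosed_univ, ⟨pure 1, trivial⟩, fun _ _ _ => trivial⟩
  obtain ⟨hXS, hmin⟩ := hX
  obtain ⟨hcl, ⟨x0, hx0⟩, hXinv⟩ := hXS
  refine ⟨x0, fun t => ?_⟩
  obtain ⟨s, ⟨x1, hx1⟩, hfin⟩ := iso_lemma z0 (hst t) X ⟨x0, hx0⟩
  let O : H → Set (Ultrafilter H) := fun h => {x | {l | h * l ∈ s} ∈ x}
  have hcover : X ⊆ ⋃ h, O h := by
    by_contra hnot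
    let Y := X \ ⋃ h, O h
    have hY : Y ∈ S := by
      refine ⟨hcl.sdiff (isOpen_iUnion fun h => ultrafilter_isOpen_basic _), ?_, ?_⟩
      · exact Set.sdiff_nonempty.2 hnot
      · rintro h x ⟨hx, hxn⟩
        refine ⟨hXinv h x hx, fun hmem => hxn ?_⟩
        obtain ⟨k, hk⟩ := Set.mem_iUnion.1 hmem
        refine Set.mem_iUnion.2 ⟨k * h, ?_⟩
        have : {l | k * (h * l) ∈ s} ∈ x := hk
        change {l | k * h * l ∈ s} ∈ x
        simpa only [mul_assoc] using this
    have := hmin hY Set.sdiff_subset hx1.1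
    refine this.2 (Set.mem_iUnion.2 ⟨1, ?_⟩)
    change {l | 1 * l ∈ s} ∈ x1
    simpa using hx1.2
  obtain ⟨F, hF⟩ := hcl.isCompact.elim_finite_subcover O (fun h => ultrafilter_isOpen_basic _) hcover
  have hDfin : (DD (R t) z0 '' X).Finite := by
    refine Set.Finite.subset (Set.Finite.biUnion (Finset.finite_toSet F)
      (fun h _ => (hfin.image (fun D => h⁻¹ • D)))) ?_
    rintro _ ⟨x, hx, rfl⟩
    obtain ⟨h, hh, hxO⟩ := Set.mem_iUnion₂.1 (hF hx)
    refine Set.mem_iUnion₂.2 ⟨h, hh, ?_⟩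
    refine ⟨_, ⟨x.map (h * ·), ⟨hXinv h x hx, hxO⟩, rfl⟩, ?_⟩
    simp only [DD_map (hinv t), inv_smul_smul]
  refine hDfin.subset ?_
  rintro _ ⟨h, rfl⟩
  exact ⟨x0.map (h * ·), hXinv h x0 hx0, DD_map (hinv t) x0 h⟩

theorem ev_orbit (x : Ultrafilter H) (D : Set A) (hD : (MulAction.orbit H D).Finite) :
    ∃ π : MulAction.orbit H D → MulAction.orbit H D, ∀ᶠ h in (x : Filter H),
      ∀ E : MulAction.orbit H D, h • E = π E := by
  have := hD.to_subtype
  obtain ⟨c, hc⟩ := ev_const x (fun h : H => fun E : MulAction.orbit H D => h • E)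
  exact ⟨c, hc.mono fun h hh E => congrFun hh E⟩

theorem C1 (x : Ultrafilter H) (D : Set A) (hD : (MulAction.orbit H D).Finite) :
    ∀ᶠ h in (x : Filter H), ∀ᶠ l in (x : Filter H), ∀ k : H, h • k • D = l • k • D := by
  obtain ⟨π, hπ⟩ := ev_orbit x D hD
  refine hπ.mono fun h hh => hπ.mono fun l hl k => ?_
  have h1 := hh ⟨k • D, k, rfl⟩
  have h2 := hl ⟨k • D, k, rfl⟩
  exact congrArg Subtype.val (h1.trans h2.symm)

theorem C2 (x : Ultrafilter H) (D : Set A) (hD : (MulAction.orbit H D).Finite) (z : A) :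
    ∀ᶠ h in (x : Filter H), ∀ᶠ l in (x : Filter H), ∀ k : H,
      (k • h⁻¹ • l • z ∈ D ↔ k • z ∈ D) := by
  refine (C1 x D hD).mono fun h hh => hh.mono fun l hl k => ?_
  have := hl k⁻¹
  have e1 : k • h⁻¹ • l • z ∈ D ↔ l • z ∈ h • k⁻¹ • D := by
    simp [Set.mem_smul_set_iff_inv_smul_mem]
  rw [e1, this]
  simp [Set.mem_smul_set_iff_inv_smul_mem]

variable {R : Z → Z → Prop} {z0 : Z}

theorem uniq_r (h1 : NL R) (h2 : NL (fun v u => R u v))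
    (hinv : ∀ (h : H) u v, R (h • u) (h • v) ↔ R u v) (x x' : Ultrafilter H)
    (hx : (MulAction.orbit H (DD (fun v u => R u v) z0 x)).Finite)
    (hx' : (MulAction.orbit H (DD R z0 x')).Finite) :
    (∀ᶠ h in (x : Filter H), ∀ᶠ l in (x : Filter H), R (h • z0) (l • z0)) ↔
    (∀ᶠ h in (x' : Filter H), ∀ᶠ l in (x' : Filter H), R (h • z0) (l • z0)) := by
  have G := lim_comm_iff (R := fun p q : H × H => R (p.1⁻¹ • p.2 • z0) (q.1⁻¹ • q.2 • z0))
    (h1.comp (fun p : H × H => p.1⁻¹ • p.2 • z0) (fun q : H × H => q.1⁻¹ • q.2 • z0))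
    (h2.comp (fun p : H × H => p.1⁻¹ • p.2 • z0) (fun q : H × H => q.1⁻¹ • q.2 • z0))
    (prodU x x) (prodU x' x')
  simp only [ev_prodU] at G
  have e1 : (∀ᶠ h in (x : Filter H), ∀ᶠ l in (x : Filter H), ∀ᶠ h' in (x' : Filter H),
      ∀ᶠ l' in (x' : Filter H), R (h⁻¹ • l • z0) (h'⁻¹ • l' • z0)) ↔
      (∀ᶠ h in (x' : Filter H), ∀ᶠ l in (x' : Filter H), R (h • z0) (l • z0)) := by
    have hc := C2 x _ hx' z0
    have : ∀ᶠ h in (x : Filter H), ∀ᶠ l in (x : Filter H), ((∀ᶠ h' in (x' : Filter H),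
      ∀ᶠ l' in (x' : Filter H), R (h⁻¹ • l • z0) (h'⁻¹ • l' • z0)) ↔
      (∀ᶠ h in (x' : Filter H), ∀ᶠ l in (x' : Filter H), R (h • z0) (l • z0))) := by
      refine hc.mono fun h hh => hh.mono fun l hl => ?_
      refine Filter.eventually_congr (Filter.Eventually.of_forall fun h' => ?_)
      refine Iff.trans ?_ (hl h')
      refine Filter.eventually_congr (Filter.Eventually.of_forall fun l' => ?_)
      rw [← hinv h', smul_inv_smul]
    rw [Filter.eventually_congr (this.mono fun h hh => Filter.eventually_congr hh)]
    simp
  have e2 : (∀ᶠ h' in (x' : Filter H), ∀ᶠ l' in (x' : Filter H), ∀ᶠ h in (x : Filter H),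
      ∀ᶠ l in (x : Filter H), R (h⁻¹ • l • z0) (h'⁻¹ • l' • z0)) ↔
      (∀ᶠ h in (x : Filter H), ∀ᶠ l in (x : Filter H), R (l • z0) (h • z0)) := by
    have hc := C2 x' _ hx z0
    have : ∀ᶠ h' in (x' : Filter H), ∀ᶠ l' in (x' : Filter H), ((∀ᶠ h in (x : Filter H),
      ∀ᶠ l in (x : Filter H), R (h⁻¹ • l • z0) (h'⁻¹ • l' • z0)) ↔
      (∀ᶠ h in (x : Filter H), ∀ᶠ l in (x : Filter H), R (l • z0) (h • z0))) := by
      refine hc.mono fun h hh => hh.mono fun l hl => ?_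
      refine Filter.eventually_congr (Filter.Eventually.of_forall fun h' => ?_)
      refine Iff.trans ?_ (hl h')
      refine Filter.eventually_congr (Filter.Eventually.of_forall fun l' => ?_)
      rw [← hinv h', smul_inv_smul]
    rw [Filter.eventually_congr (this.mono fun h hh => Filter.eventually_congr hh)]
    simp
  rw [← e1, G, e2]
  exact lim_comm_iff (h1.comp (fun h : H => h • z0) (fun h : H => h • z0))
    (h2.comp (fun h : H => h • z0) (fun h : H => h • z0)) x x

theorem triv_r (h1 : NL R) (h2 : NL (fun v u => R u v)) (x : Ultrafilter H) (g : H)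
    (hg : ∀ k : H, g • k • (DD (fun v u => R u v) z0 x) = k • (DD (fun v u => R u v) z0 x)) :
    (∀ᶠ h in (x : Filter H), ∀ᶠ l in (x : Filter H), R (h • z0) (l • g • z0)) ↔
    (∀ᶠ h in (x : Filter H), ∀ᶠ l in (x : Filter H), R (h • z0) (l • z0)) := by
  rw [lim_comm_iff (h1.comp (fun h : H => h • z0) (fun h : H => h • g • z0))
    (h2.comp (fun h : H => h • g • z0) (fun h : H => h • z0)) x x,
    lim_comm_iff (h1.comp (fun h : H => h • z0) (fun h : H => h • z0))
    (h2.comp (fun h : H => h • z0) (fun h : H => h • z0)) x x]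
  refine Filter.eventually_congr (Filter.Eventually.of_forall fun l => ?_)
  change l • g • z0 ∈ DD (fun v u => R u v) z0 x ↔ l • z0 ∈ DD (fun v u => R u v) z0 x
  have e1 : l • g • z0 ∈ DD (fun v u => R u v) z0 x ↔
      g • z0 ∈ l⁻¹ • DD (fun v u => R u v) z0 x := by
    simp [Set.mem_smul_set_iff_inv_smul_mem]
  rw [e1, ← hg l⁻¹]
  simp [Set.mem_smul_set_iff_inv_smul_mem]

end Flow

end PartA

/-! ### Part B: model theoretic tools -/

section PartB

open Filter

variable {L : Language.{u, v}}

theorem fin_vars {γ : Type*} (θ : L.Formula γ) :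
    ∃ (s : Finset γ) (θ' : L.Formula s), ∀ (M : Type w) [L.Structure M] (v : γ → M),
      θ.Realize v ↔ θ'.Realize (fun i : s => v i) := by
  classical
  refine ⟨θ.freeVarFinset, BoundedFormula.restrictFreeVar θ id, fun M _ v => ?_⟩
  exact (BoundedFormula.realize_restrictFreeVar (φ := θ) (f := id) v (fun a => rfl)).symm

/-- no formula has a ladder in the structure -/
def StableStr (L : Language.{u, v}) (E : Type w) [L.Structure E] : Prop :=
  ∀ (nx ny : ℕ) (φ : L.Formula (Fin nx ⊕ Fin ny)),
    NL (fun (a : Fin nx → E) (b : Fin ny → E) => φ.Realize (Sum.elim a b))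

theorem StableStr.nl {E : Type w} [L.Structure E] (hE : StableStr L E) {α β : Type*}
    (θ : L.Formula (α ⊕ β)) :
    NL (fun (a : α → E) (b : β → E) => θ.Realize (Sum.elim a b)) := by
  classical
  obtain ⟨s, θ', h⟩ := fin_vars.{u, v, w} θ
  let eA := s.toLeft.equivFin
  let eB := s.toRight.equivFin
  let ρ : s → Fin s.toLeft.card ⊕ Fin s.toRight.card := fun i =>
    match i with
    | ⟨Sum.inl a, h⟩ => Sum.inl (eA ⟨a, Finset.mem_toLeft.2 h⟩)
    | ⟨Sum.inr b, h⟩ => Sum.inr (eB ⟨b, Finset.mem_toRight.2 h⟩)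
  have key := (hE _ _ (θ'.relabel ρ)).comp (fun (a : α → E) i => a (eA.symm i))
    (fun (b : β → E) i => b (eB.symm i))
  have : (fun (a : α → E) (b : β → E) => θ.Realize (Sum.elim a b)) =
    fun (a : α → E) (b : β → E) => (θ'.relabel ρ).Realize (Sum.elim (fun i => a (eA.symm i))
      (fun i => b (eB.symm i))) := by
    funext a b
    rw [h E, Formula.realize_relabel]
    have e : (fun i : s => (Sum.elim a b : α ⊕ β → E) i) =
      (Sum.elim (fun i => a (eA.symm i)) (fun i => b (eB.symm i)) :
        Fin s.toLeft.card ⊕ Fin s.toRight.card → E) ∘ ρ := by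
      funext i
      rcases i with ⟨a | b, hi⟩ <;> simp [ρ]
    rw [e]
  rw [this]
  exact key

theorem realize_swap {E : Type w} [L.Structure E] {α β : Type*} (θ : L.Formula (α ⊕ β))
    (a : α → E) (b : β → E) :
    (θ.relabel Sum.swap).Realize (Sum.elim b a) ↔ θ.Realize (Sum.elim a b) := by
  rw [Formula.realize_relabel]
  have : (Sum.elim b a ∘ Sum.swap : α ⊕ β → E) = Sum.elim a b := by
    funext i; cases i <;> rfl
  rw [this]

theorem StableStr.nl_op {E : Type w} [L.Structure E] (hE : StableStr L E) {α β : Type*}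
    (θ : L.Formula (α ⊕ β)) :
    NL (fun (b : β → E) (a : α → E) => θ.Realize (Sum.elim a b)) := by
  have := hE.nl (θ.relabel Sum.swap)
  simpa only [realize_swap] using this

theorem StableStr.nl_diff {E : Type w} [L.Structure E] (hE : StableStr L E) {α β : Type*}
    (θ : L.Formula (α ⊕ β)) :
    NL (fun (p : (α → E) × (α → E)) (b : β → E) =>
      θ.Realize (Sum.elim p.1 b) ∧ ¬ θ.Realize (Sum.elim p.2 b)) := by
  let ψ : L.Formula ((α ⊕ α) ⊕ β) :=
    θ.relabel (Sum.map Sum.inl id) ⊓ ∼(θ.relabel (Sum.map Sum.inr id))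
  have := (hE.nl ψ).comp (fun p : (α → E) × (α → E) => Sum.elim p.1 p.2) id
  have e1 : ∀ (p : (α → E) × (α → E)) (b : β → E),
    (Sum.elim (Sum.elim p.1 p.2) b ∘ Sum.map Sum.inl id : α ⊕ β → E) = Sum.elim p.1 b := by
    intro p b; funext i; cases i <;> rfl
  have e2 : ∀ (p : (α → E) × (α → E)) (b : β → E),
    (Sum.elim (Sum.elim p.1 p.2) b ∘ Sum.map Sum.inr id : α ⊕ β → E) = Sum.elim p.2 b := by
    intro p b; funext i; cases i <;> rfl
  simpa only [ψ, Formula.realize_inf, Formula.realize_not, Formula.realize_relabel, e1, e2,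
    id] using this

/-- Two tuples have the same type. -/
def SameT (L : Language.{u, v}) {α : Type*} {P E : Type*} [L.Structure P] [L.Structure E]
    (a : α → P) (b : α → E) : Prop :=
  ∀ ψ : L.Formula α, ψ.Realize a ↔ ψ.Realize b

/-- elementary map -/
def Elem (L : Language.{u, v}) {P E : Type*} [L.Structure P] [L.Structure E] (f : P → E) : Prop :=
  SameT L (fun p : P => p) f

section
variable {P E F : Type*} [L.Structure P] [L.Structure E] [L.Structure F]

theorem SameT.comp {α β : Type*} {a : α → P} {b : α → E} (h : SameT L a b) (f : β → α) :
    SameT L (fun i => a (f i)) (fun i => b (f i)) := by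
  intro ψ
  have := h (ψ.relabel f)
  simpa only [Formula.realize_relabel, Function.comp_def] using this

theorem SameT.symm {α : Type*} {a : α → P} {b : α → E} (h : SameT L a b) : SameT L b a :=
  fun ψ => (h ψ).symm

theorem SameT.trans {α : Type*} {a : α → P} {b : α → E} {c : α → F} (h : SameT L a b)
    (h' : SameT L b c) : SameT L a c := fun ψ => (h ψ).trans (h' ψ)

theorem SameT.eq_iff {α : Type*} {a : α → P} {b : α → E} (h : SameT L a b) (i j : α) :
    a i = a j ↔ b i = b j := by
  have := h (Term.equal (Term.var i) (Term.var j))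
  simpa [Formula.realize_equal] using this

theorem Elem.real {f : P → E} (h : Elem L f) {γ : Type*} (ψ : L.Formula γ) (v : γ → P) :
    ψ.Realize (fun i => f (v i)) ↔ ψ.Realize v := (SameT.comp h v ψ).symm

theorem Elem.same {f : P → E} (h : Elem L f) {γ : Type*} (v : γ → P) :
    SameT L v (fun i => f (v i)) := SameT.comp h v

theorem Elem.inj {f : P → E} (h : Elem L f) : Function.Injective f := fun i j hij =>
  (SameT.eq_iff h i j).2 hij

theorem Elem.comp {f : P → E} {g : E → F} (hg : Elem L g) (hf : Elem L f) :
    Elem L (fun p => g (f p)) := SameT.trans hf (hg.same f)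

theorem Elem.id : Elem L (fun p : P => p) := fun _ => Iff.rfl

theorem Elem.stable {P E : Type w} [L.Structure P] [L.Structure E] {f : P → E} (h : Elem L f)
    (hE : StableStr L E) : StableStr L P := by
  intro nx ny φ
  have := (hE nx ny φ).comp (fun (a : Fin nx → P) i => f (a i)) (fun (b : Fin ny → P) i => f (b i))
  have e : ∀ (a : Fin nx → P) (b : Fin ny → P), (Sum.elim (fun i => f (a i)) (fun i => f (b i)) :
      Fin nx ⊕ Fin ny → E) = fun i => f (Sum.elim a b i) := by
    intro a b; funext i; cases i <;> rfl
  simpa only [e, h.real] using this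

theorem Elem.funMap {f : P → E} (h : Elem L f) {n : ℕ} (F : L.Functions n) (x : Fin n → P) :
    f (funMap F x) = Structure.funMap F (fun i => f (x i)) := by
  have := (h.real (Term.equal (Term.var (none : Option (Fin n)))
    (Term.func F (fun i => Term.var (some i)))) (fun o => o.elim (Structure.funMap F x) x)).2
    (by simp [Formula.realize_equal])
  simpa [Formula.realize_equal] using this

theorem Elem.relMap {f : P → E} (h : Elem L f) {n : ℕ} (R : L.Relations n) (x : Fin n → P) :
    RelMap R (fun i => f (x i)) ↔ RelMap R x := by
  have := h.real (R.formula (fun i => Term.var i)) x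
  simpa [Formula.realize_rel] using this

theorem Elem.sentence {f : P → E} (h : Elem L f) (φ : L.Sentence) : P ⊨ φ ↔ E ⊨ φ := by
  have := h.real φ (default : Empty → P)
  rw [Sentence.Realize, Sentence.Realize, ← this]
  have : (fun i => f ((default : Empty → P) i)) = (default : Empty → E) := Subsingleton.elim _ _
  rw [this]

/-- bundling -/
def Elem.toEmb {f : P → E} (h : Elem L f) : P ↪[L] E where
  toFun := f
  inj' := h.inj
  map_fun' F x := h.funMap F x
  map_rel' R x := h.relMap R x

end

/-- Ultrapowers. -/
abbrev UP {I : Type*} (U : Ultrafilter I) (E : Type*) : Type _ := (U : Filter I).Product (fun _ => E)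

/-- class of a function in the ultrapower -/
def UP.mk {I : Type*} (U : Ultrafilter I) {E : Type*} (f : I → E) : UP U E :=
  Quotient.mk'' (s₁ := (U : Filter I).productSetoid (fun _ => E)) f

theorem UP.mk_surj {I : Type*} (U : Ultrafilter I) {E : Type*} (p : UP U E) :
    ∃ f : I → E, UP.mk U f = p := Quotient.exists_rep p

theorem UP.mk_eq {I : Type*} (U : Ultrafilter I) {E : Type*} (f g : I → E) :
    UP.mk U f = UP.mk U g ↔ ∀ᶠ i in (U : Filter I), f i = g i := Quotient.eq''

theorem los {I : Type*} (U : Ultrafilter I) {E : Type*} [L.Structure E] [Nonempty E] {γ : Type*}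
    (ψ : L.Formula γ) (F : γ → I → E) :
    ψ.Realize (fun g => UP.mk U (F g)) ↔ ∀ᶠ i in (U : Filter I), ψ.Realize (fun g => F g i) :=
  Ultraproduct.realize_formula_cast (M := fun _ : I => E) (u := U) ψ F

theorem UP.diag_elem {I : Type*} (U : Ultrafilter I) {E : Type*} [L.Structure E] [Nonempty E] :
    Elem L (fun e : E => UP.mk U (fun _ => e)) := by
  intro ψ
  rw [los]
  simp

theorem exists_UF {P E : Type w} [L.Structure P] [L.Structure E] [Nonempty E] {α : Type*}
    {a : α → P} {b : α → E} (h : SameT L a b) :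
    ∃ V : Ultrafilter (P → E), (∀ ψ : L.Formula P, ψ.Realize (fun p => p) ↔
        ∀ᶠ m in (V : Filter (P → E)), ψ.Realize m) ∧
      ∀ᶠ m in (V : Filter (P → E)), ∀ i, m (a i) = b i := by
  classical
  let A : L.Formula P → Set (P → E) := fun ψ => {m | (∀ i, m (a i) = b i) ∧ ψ.Realize m}
  have hne : ∀ ψ : L.Formula P, ψ.Realize (fun p => p) → (A ψ).Nonempty := by
    intro ψ hψ
    obtain ⟨s, ψ', hs⟩ := fin_vars.{u, v, w} ψ
    let g : s → α ⊕ s := fun e => if he : ∃ x, a x = e then Sum.inl he.choose else Sum.inr e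
    let χ : L.Formula α := Formula.iExs s (ψ'.relabel g)
    have hχ : χ.Realize a := by
      rw [Formula.realize_iExs]
      refine ⟨fun e => e, ?_⟩
      rw [Formula.realize_relabel]
      have e : (Sum.elim a (fun e : s => (e : P)) ∘ g : s → P) = fun e : s => (e : P) := by
        funext e
        by_cases he : ∃ x, a x = e
        · simpa [g, he] using he.choose_spec
        · simp [g, he]
      rw [e]
      exact (hs P _).1 hψ
    rw [h χ, Formula.realize_iExs] at hχ
    obtain ⟨i, hi⟩ := hχ
    rw [Formula.realize_relabel] at hi
    let m : P → E := fun e => if he : ∃ x, a x = e then b he.choose else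
      if hes : e ∈ s then i ⟨e, hes⟩ else Classical.arbitrary E
    refine ⟨m, fun x => ?_, ?_⟩
    · have he : ∃ x', a x' = a x := ⟨x, rfl⟩
      have := (h.eq_iff he.choose x).1 he.choose_spec
      simp only [m, he, dite_true]
      exact this
    · rw [hs E]
      have e : (fun e : s => m e) = Sum.elim b i ∘ g := by
        funext e
        by_cases he : ∃ x, a x = e
        · simp [g, m, he]
        · simp [g, m, he]
      rw [e]; exact hi
  let 𝓕 : Filter (P → E) :=
    { sets := {s | ∃ ψ : L.Formula P, ψ.Realize (fun p => p) ∧ A ψ ⊆ s}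
      univ_sets := ⟨⊤, by simp, Set.subset_univ _⟩
      sets_of_superset := fun ⟨ψ, h1, h2⟩ hst => ⟨ψ, h1, h2.trans hst⟩
      inter_sets := by
        rintro s t ⟨ψ, h1, h2⟩ ⟨ψ', h1', h2'⟩
        refine ⟨ψ ⊓ ψ', Formula.realize_inf.2 ⟨h1, h1'⟩, fun m hm => ?_⟩
        have := Formula.realize_inf.1 hm.2
        exact ⟨h2 ⟨hm.1, this.1⟩, h2' ⟨hm.1, this.2⟩⟩ }
  have hmem : ∀ s, s ∈ 𝓕 ↔ ∃ ψ : L.Formula P, ψ.Realize (fun p => p) ∧ A ψ ⊆ s :=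
    fun s => Iff.rfl
  have : 𝓕.NeBot := by
    refine Filter.neBot_iff.2 fun hbot => ?_
    obtain ⟨ψ, h1, h2⟩ := (hmem ∅).1 (by rw [hbot]; trivial)
    obtain ⟨m, hm⟩ := hne ψ h1
    exact h2 hm
  have fwd : ∀ ψ : L.Formula P, ψ.Realize (fun p => p) →
        ∀ᶠ m in (Ultrafilter.of 𝓕 : Filter (P → E)), ψ.Realize m := by
    intro ψ hψ
    exact Ultrafilter.of_le 𝓕 ((hmem _).2 ⟨ψ, hψ, fun m hm => hm.2⟩)
  refine ⟨Ultrafilter.of 𝓕, fun ψ => ⟨fwd ψ, fun hψ => ?_⟩, ?_⟩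
  · by_contra hn
    have := fwd (∼ψ) (Formula.realize_not.2 hn)
    obtain ⟨m, h1, h2⟩ := (hψ.and this).exists
    exact Formula.realize_not.1 h2 h1
  · exact Ultrafilter.of_le 𝓕 ((hmem _).2 ⟨⊤, by simp, fun m hm => hm.1⟩)

theorem amalg {P E : Type w} [L.Structure P] [L.Structure E] [Nonempty E] {α : Type*}
    {a : α → P} {b : α → E} (h : SameT L a b) :
    ∃ (E' : Type w) (_ : L.Structure E') (_ : Nonempty E') (f : E → E') (g : P → E'),
      Elem L f ∧ Elem L g ∧ ∀ i, g (a i) = f (b i) := by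
  obtain ⟨V, h1, h2⟩ := exists_UF h
  refine ⟨UP V E, inferInstance, inferInstance, fun e => UP.mk V (fun _ => e),
    fun p => UP.mk V (fun m => m p), UP.diag_elem V, fun ψ => ?_, fun i => ?_⟩
  · rw [los, h1]
  · rw [UP.mk_eq]
    exact h2.mono fun m hm => hm i

/-- The automorphism group, as elementary permutations. -/
def autG (L : Language.{u, v}) (E : Type w) [L.Structure E] : Subgroup (Equiv.Perm E) where
  carrier := {τ | Elem L τ}
  mul_mem' := fun {a b} (ha : Elem L a) (hb : Elem L b) =>
    (Elem.comp ha hb : Elem L (fun p => a (b p)))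
  one_mem' := Elem.id
  inv_mem' := by
    intro τ hτ ψ
    have := (Elem.real hτ ψ (fun i => τ⁻¹ i))
    simpa using this

theorem mem_autG {E : Type w} [L.Structure E] {τ : Equiv.Perm E} : τ ∈ autG L E ↔ Elem L τ :=
  Iff.rfl

end PartB

/-! ### Part C: rich structures -/

section PartC

open Filter

variable {L : Language.{u, v}}

theorem Elem.realB {P E : Type*} [L.Structure P] [L.Structure E] {f : P → E} (h : Elem L f)
    {γ : Type*} {k : ℕ} (φ : L.BoundedFormula γ k) (v : γ → P) (xs : Fin k → P) :
    φ.Realize (f ∘ v) (f ∘ xs) ↔ φ.Realize v xs := by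
  have := h.real φ.toFormula (Sum.elim v xs)
  rw [BoundedFormula.realize_toFormula, BoundedFormula.realize_toFormula] at this
  exact this

theorem elem_chain (G : ℕ → Type w) [∀ n, L.Structure (G n)] (e : ∀ n, G n → G (n + 1))
    (he : ∀ n, Elem L (e n)) :
    ∃ (E : Type w) (_ : L.Structure E) (o : ∀ n, G n → E),
      (∀ n, Elem L (o n)) ∧ (∀ n x, o (n + 1) (e n x) = o n x) ∧ ∀ z, ∃ n x, o n x = z := by
  let f' : ∀ n, G n ↪[L] G (n + 1) := fun n => (he n).toEmb
  let f := DirectedSystem.natLERec f'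
  have hf : ∀ m n (h : m ≤ n), Elem L (f m n h) := by
    intro m n h
    induction n, h using Nat.le_induction with
    | base =>
      have : (f m m le_rfl : G m → G m) = fun x => x := by
        funext x
        exact DirectedSystem.map_self' (f := fun i j h => f i j h) x
      rw [this]
      exact Elem.id
    | succ n h ih =>
      have : (f m (n + 1) (Nat.le_succ_of_le h) : G m → G (n + 1)) =
          fun x => e n (f m n h x) := by
        funext x
        simp only [f, DirectedSystem.coe_natLERec]
        rw [Nat.leRecOn_succ h]
        rfl
      rw [this]
      exact (he n).comp ih
  let E := Language.DirectLimit G f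
  let o : ∀ n, G n ↪[L] E := fun n => Language.DirectLimit.of L ℕ G f n
  have hof : ∀ m n (h : m ≤ n) x, o n (f m n h x) = o m x := fun m n h x => Language.DirectLimit.of_f
  have key : ∀ {γ : Type w} {k : ℕ} (φ : L.BoundedFormula γ k) (n : ℕ) (v : γ → G n)
      (xs : Fin k → G n), φ.Realize (o n ∘ v) (o n ∘ xs) ↔ φ.Realize v xs := by
    intro γ k φ
    induction φ with
    | falsum => intros; exact Iff.rfl
    | equal t₁ t₂ =>
      intro n v xs
      exact ((BoundedFormula.IsAtomic.equal t₁ t₂).isQF).realize_embedding (o n)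
    | rel R ts =>
      intro n v xs
      exact ((BoundedFormula.IsAtomic.rel R ts).isQF).realize_embedding (o n)
    | imp _ _ ih1 ih2 =>
      intro n v xs
      simp only [BoundedFormula.realize_imp, ih1 n v xs, ih2 n v xs]
    | all φ ih =>
      intro n v xs
      constructor
      · intro h
        rw [BoundedFormula.realize_all] at h ⊢
        intro a
        have := h (o n a)
        rw [← Fin.comp_snoc, ih] at this
        exact this
      · intro h
        rw [BoundedFormula.realize_all]
        intro z
        obtain ⟨m, x, rfl⟩ := Language.DirectLimit.exists_of z
        let N := max n m
        have hz : Language.DirectLimit.of L ℕ G f m x = o N (f m N (le_max_right _ _) x) :=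
          (hof m N (le_max_right _ _) x).symm
        have hv : o n ∘ v = o N ∘ (f n N (le_max_left _ _) ∘ v) := by
          funext i; exact (hof n N (le_max_left _ _) (v i)).symm
        have hxs : o n ∘ xs = o N ∘ (f n N (le_max_left _ _) ∘ xs) := by
          funext i; exact (hof n N (le_max_left _ _) (xs i)).symm
        rw [hz, hv, hxs, ← Fin.comp_snoc, ih]
        have h2 := ((hf n N (le_max_left _ _)).realB φ.all v xs).2 h
        rw [BoundedFormula.realize_all] at h2
        exact h2 _
  refine ⟨E, inferInstance, fun n => o n, fun n ψ => ?_, fun n x => ?_, Language.DirectLimit.exists_of⟩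
  · have := key ψ n (fun p => p) default
    rw [Formula.Realize, Formula.Realize, ← this]
    have e : (default : Fin 0 → E) = o n ∘ default := Subsingleton.elim _ _
    rw [e]
    rfl
  · have := hof n (n + 1) (Nat.le_succ n) x
    change o (n + 1) (e n x) = o n x
    rw [← this]
    congr 1
    simp only [f, DirectedSystem.coe_natLERec]
    rw [Nat.leRecOn_succ le_rfl, Nat.leRecOn_self]
    rfl

theorem exists_next (E : Type w) [L.Structure E] [Nonempty E] :
    ∃ (E' : Type w) (_ : L.Structure E') (_ : Nonempty E') (ι : E → E'), Elem L ι ∧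
      ∀ V : Ultrafilter (E → E), ∃ c : E → E', ∀ θ : L.Formula (E ⊕ E),
        θ.Realize (Sum.elim ι c) ↔
          ∀ᶠ m in (V : Filter (E → E)), θ.Realize (Sum.elim (fun e => e) m) := by
  let 𝓕 : Filter (Ultrafilter (E → E) → (E → E)) :=
    Filter.pi (fun V : Ultrafilter (E → E) => (V : Filter (E → E)))
  let U : Ultrafilter (Ultrafilter (E → E) → (E → E)) := Ultrafilter.of 𝓕
  refine ⟨UP U E, inferInstance, inferInstance, fun e => UP.mk U (fun _ => e),
    UP.diag_elem U, fun V => ⟨fun e => UP.mk U (fun ω => ω V e), fun θ => ?_⟩⟩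
  have h1 : ∀ p : (E → E) → Prop, (∀ᶠ m in (V : Filter (E → E)), p m) →
      ∀ᶠ ω in (U : Filter (Ultrafilter (E → E) → (E → E))), p (ω V) := by
    intro p hp
    have : Tendsto (Function.eval V) 𝓕 (V : Filter (E → E)) := Filter.tendsto_eval_pi _ V
    exact (Ultrafilter.of_le 𝓕) (this hp)
  have h2 : ∀ p : (E → E) → Prop, (∀ᶠ m in (V : Filter (E → E)), p m) ↔
      ∀ᶠ ω in (U : Filter (Ultrafilter (E → E) → (E → E))), p (ω V) := by
    intro p
    refine ⟨h1 p, fun h => ?_⟩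
    by_contra hn
    rw [← Ultrafilter.eventually_not] at hn
    obtain ⟨ω, a, b⟩ := (h.and (h1 _ hn)).exists
    exact b a
  rw [h2]
  have := los U θ (Sum.elim (fun e => fun _ => e) (fun e => fun ω => ω V e))
  have e1 : (fun g => UP.mk U ((Sum.elim (fun e => fun _ => e) (fun e => fun ω => ω V e) :
      E ⊕ E → _ → E) g)) = Sum.elim (fun e => UP.mk U (fun _ => e))
        (fun e => UP.mk U (fun ω => ω V e)) := by
    funext i; cases i <;> rfl
  have e2 : ∀ ω : Ultrafilter (E → E) → (E → E), (fun g => (Sum.elim (fun e => fun _ => e) (fun e => fun ω => ω V e) :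
      E ⊕ E → (Ultrafilter (E → E) → (E → E)) → E) g ω) = Sum.elim (fun e => e) (ω V) := by
    intro ω; funext i; cases i <;> rfl
  rw [e1] at this
  simp only [e2] at this
  exact this

/-- Rich structures with their filtration. -/
structure Rich (L : Language.{u, v}) (E : Type w) [L.Structure E] (S : ℕ → Set E) : Prop where
  ne : Nonempty E
  mono : Monotone S
  cover : ∀ e, ∃ n, e ∈ S n
  elemS : ∀ n, ∃ (E0 : Type w) (_ : L.Structure E0) (_ : Nonempty E0) (j : E0 → E),
    Elem L j ∧ Set.range j = S n
  real : ∀ n (V : Ultrafilter (E → E)), (∀ᶠ m in (V : Filter (E → E)), ∀ e ∈ S n, m e ∈ S n) →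
    ∃ c : E → E, (∀ e ∈ S n, c e ∈ S (n + 1)) ∧ ∀ θ : L.Formula (S n ⊕ S n),
      θ.Realize (Sum.elim (fun e => (e : E)) (fun e => c e)) ↔
        ∀ᶠ m in (V : Filter (E → E)), θ.Realize (Sum.elim (fun e => (e : E)) (fun e => m e))

/-- bundled nonempty structures -/
structure NStr (L : Language.{u, v}) where
  E : Type w
  str : L.Structure E
  ne : Nonempty E

/-- iteration -/
def NStr.iter (nx : NStr.{u, v, w} L → NStr.{u, v, w} L) (X : NStr.{u, v, w} L) :
    ℕ → NStr.{u, v, w} L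
  | 0 => X
  | n + 1 => nx (NStr.iter nx X n)

attribute [instance] NStr.str NStr.ne

theorem exists_rich (E0 : Type w) [L.Structure E0] [Nonempty E0] :
    ∃ (E : Type w) (_ : L.Structure E) (S : ℕ → Set E) (f : E0 → E), Rich L E S ∧ Elem L f ∧
      ∀ e, f e ∈ S 0 := by
  classical
  have hn : ∀ X : NStr.{u, v, w} L, ∃ (Y : NStr.{u, v, w} L) (ι : X.E → Y.E), Elem L ι ∧
      ∀ V : Ultrafilter (X.E → X.E), ∃ c : X.E → Y.E, ∀ θ : L.Formula (X.E ⊕ X.E),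
        θ.Realize (Sum.elim ι c) ↔
          ∀ᶠ m in (V : Filter (X.E → X.E)), θ.Realize (Sum.elim (fun e => e) m) := by
    intro X
    obtain ⟨E', h1, h2, ι, h3, h4⟩ := exists_next (L := L) X.E
    exact ⟨⟨E', h1, h2⟩, ι, h3, h4⟩
  choose nx ι hι hc using hn
  let ch : ℕ → NStr.{u, v, w} L := NStr.iter nx ⟨E0, inferInstance, inferInstance⟩
  have hch : ∀ n, ch (n + 1) = nx (ch n) := fun n => rfl
  obtain ⟨E, _, o, ho1, ho2, ho3⟩ := @elem_chain L (fun n => (ch n).E) (fun n => (ch n).str) (fun n => ι (ch n))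
    (fun n => hι (ch n))
  refine ⟨E, inferInstance, fun n => Set.range (o n), o 0, ⟨?_, ?_, ?_, ?_, ?_⟩, ho1 0,
    fun e => ⟨e, rfl⟩⟩
  · exact ⟨o 0 (Classical.choice (ch 0).ne)⟩
  · refine monotone_nat_of_le_succ fun n => ?_
    rintro _ ⟨x, rfl⟩
    exact ⟨ι (ch n) x, ho2 n x⟩
  · intro e
    obtain ⟨n, x, rfl⟩ := ho3 e
    exact ⟨n, x, rfl⟩
  · intro n
    exact ⟨(ch n).E, (ch n).str, (ch n).ne, o n, ho1 n, rfl⟩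
  · intro n V hV
    let X := (ch n).E
    let ret : E → X := fun e => if h : ∃ x, o n x = e then h.choose
      else Classical.choice (ch n).ne
    have hret : ∀ x : X, ret (o n x) = x := by
      intro x
      have h : ∃ x', o n x' = o n x := ⟨x, rfl⟩
      have := h.choose_spec
      simp only [ret, h, dite_true]
      exact (ho1 n).inj this
    have hret' : ∀ e ∈ Set.range (o n), o n (ret e) = e := by
      rintro _ ⟨x, rfl⟩
      rw [hret]
    let tr : (E → E) → (X → X) := fun m x => ret (m (o n x))
    obtain ⟨c', hc'⟩ := hc (ch n) (V.map tr)
    refine ⟨fun e => o (n + 1) (c' (ret e)), ?_, ?_⟩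
    · rintro e -
      exact ⟨_, rfl⟩
    · intro θ
      let ρ : (Set.range (o n) : Set E) ⊕ (Set.range (o n) : Set E) → X ⊕ X :=
        Sum.map (fun e => ret e) (fun e => ret e)
      have h0 := (ho1 (n + 1)).real (θ.relabel ρ)
        (Sum.elim (ι (ch n)) c' : X ⊕ X → (ch (n + 1)).E)
      have h1 := h0.trans (hc' (θ.relabel ρ))
      rw [Formula.realize_relabel] at h1
      have e1 : ((fun i => o (n + 1) ((Sum.elim (ι (ch n)) c' : X ⊕ X → (ch (n + 1)).E) i)) ∘ ρ) =
          Sum.elim (fun e : (Set.range (o n) : Set E) => (e : E))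
            (fun e : (Set.range (o n) : Set E) => o (n + 1) (c' (ret e))) := by
        funext i
        rcases i with i | i
        · change o (n + 1) (ι (ch n) (ret i)) = i
          rw [ho2, hret' _ i.2]
        · rfl
      have h2 := (iff_of_eq (congrArg θ.Realize e1)).symm.trans h1
      refine h2.trans ?_
      change (∀ᶠ m in (V : Filter (E → E)), (θ.relabel ρ).Realize (Sum.elim _ (tr m))) ↔ _
      refine Filter.eventually_congr (hV.mono fun m hm => ?_)
      rw [← (ho1 n).real, Formula.realize_relabel]
      have e2 : ((fun i => o n ((Sum.elim (fun e => e) (tr m) : X ⊕ X → _) i)) ∘ ρ) =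
          Sum.elim (fun e : (Set.range (o n) : Set E) => (e : E))
            (fun e : (Set.range (o n) : Set E) => m e) := by
        funext i
        rcases i with i | i
        · exact hret' _ i.2
        · change o n (ret (m (o n (ret i)))) = m i
          rw [hret' _ i.2, hret' _ (hm _ i.2)]
      rw [e2]

variable {E : Type w} [L.Structure E] {S : ℕ → Set E}

theorem Rich.real' (hR : Rich L E S) (n : ℕ) (V : Ultrafilter (E → E))
    (hV : ∀ᶠ m in (V : Filter (E → E)), ∀ e ∈ S n, m e ∈ S n) :
    ∃ c : E → E, (∀ e ∈ S n, c e ∈ S (n + 1)) ∧ ∀ {γ δ : Type w} (θ : L.Formula (γ ⊕ δ))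
      (a : γ → E) (b : δ → E), (∀ i, a i ∈ S n) → (∀ i, b i ∈ S n) →
      (θ.Realize (Sum.elim a (fun i => c (b i))) ↔
        ∀ᶠ m in (V : Filter (E → E)), θ.Realize (Sum.elim a (fun i => m (b i)))) := by
  obtain ⟨c, h1, h2⟩ := hR.real n V hV
  refine ⟨c, h1, fun {γ δ} θ a b ha hb => ?_⟩
  have := h2 (θ.relabel (Sum.map (fun i => ⟨a i, ha i⟩) (fun i => ⟨b i, hb i⟩)))
  simp only [Formula.realize_relabel, Sum.elim_comp_map] at this
  exact this

theorem elem_of_local (hR : Rich L E S) {F : Type w} [L.Structure F] (τ : E → F)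
    (h : ∀ n, ∃ N, n ≤ N ∧ SameT L (fun e : S N => (e : E)) (fun e : S N => τ e)) :
    Elem L τ := by
  intro ψ
  obtain ⟨s, ψ', hs⟩ := fin_vars.{u, v, w} ψ
  choose κ hκ using hR.cover
  obtain ⟨N, hN, hS⟩ := h (s.sup κ)
  have hmem : ∀ e ∈ s, e ∈ S N := fun e he =>
    hR.mono ((Finset.le_sup (f := κ) he).trans hN) (hκ e)
  rw [hs E, hs F]
  exact (hS.comp (fun e : s => ⟨e, hmem e e.2⟩)) ψ'

theorem Rich.step (hR : Rich L E S) (n : ℕ) {α : Type w} (a b : α → E) (ha : ∀ i, a i ∈ S n)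
    (hb : ∀ i, b i ∈ S n) (hab : SameT L a b) :
    ∃ f : E → E, ((∀ e ∈ S n, f e ∈ S (n + 1)) ∧
      SameT L (fun e : S n => (e : E)) (fun e : S n => f e)) ∧ ∀ i, f (a i) = b i := by
  obtain ⟨E0, _, _, j, hj, hjr⟩ := hR.elemS n
  have hb' : ∀ i, ∃ x, j x = b i := fun i => by
    have := hb i
    rw [← hjr] at this
    exact this
  choose b0 hb0 using hb'
  have hsame : SameT L a b0 := by
    refine hab.trans (SameT.symm ?_)
    have := hj.same b0
    simpa only [hb0] using this
  obtain ⟨V, h1, h2⟩ := exists_UF hsame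
  obtain ⟨c, hc1, hc2⟩ := hR.real' n (V.map (fun m e => j (m e))) (by
    refine Filter.Eventually.of_forall (fun m => ?_) (f := (V : Filter (E → E0)))
    intro e _
    rw [← hjr]
    exact ⟨_, rfl⟩)
  refine ⟨c, ⟨hc1, fun ψ => ?_⟩, fun i => ?_⟩
  · have h3 := hc2 (ψ.relabel (Sum.inr : S n → PEmpty.{w + 1} ⊕ S n)) PEmpty.elim
      (fun e : S n => (e : E)) (fun i => i.elim) (fun i => i.2)
    simp only [Formula.realize_relabel, Sum.elim_comp_inr] at h3
    rw [h3]
    change _ ↔ ∀ᶠ m in (V : Filter (E → E0)), ψ.Realize (fun i : S n => j (m i))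
    simp only [hj.real]
    have h4 := h1 (ψ.relabel (fun e : S n => (e : E)))
    simp only [Formula.realize_relabel] at h4
    exact h4
  · have h3 := hc2 (Term.equal (Term.var (Sum.inl PUnit.unit)) (Term.var (Sum.inr PUnit.unit)) :
      L.Formula (PUnit.{w + 1} ⊕ PUnit.{w + 1})) (fun _ => b i) (fun _ => a i)
      (fun _ => hb i) (fun _ => ha i)
    simp only [Formula.realize_equal, Term.realize_var, Sum.elim_inl, Sum.elim_inr] at h3
    refine (h3.2 ?_).symm
    change ∀ᶠ m in (V : Filter (E → E0)), b i = j (m (a i))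
    refine h2.mono fun m hm => ?_
    rw [hm, hb0]

theorem Rich.homog (hR : Rich L E S) (n : ℕ) {α : Type w} (a b : α → E) (ha : ∀ i, a i ∈ S n)
    (hb : ∀ i, b i ∈ S n) (hab : SameT L a b) :
    ∃ τ ∈ autG L E, ∀ i, τ (a i) = b i := by
  classical
  let Pr : ℕ → (E → E) → Prop := fun k f => (∀ e ∈ S (n + k), f e ∈ S (n + k + 1)) ∧
      SameT L (fun e : S (n + k) => (e : E)) (fun e : S (n + k) => f e)
  obtain ⟨f0, hf0, hf0a⟩ := hR.step n a b ha hb hab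
  have stp : ∀ k (f : {f : E → E // Pr k f}), ∃ f' : {f : E → E // Pr (k + 1) f},
      ∀ e ∈ S (n + k), f'.1 (f.1 e) = e := by
    rintro k ⟨f, hf1, hf2⟩
    obtain ⟨f', hf', hff⟩ := hR.step (n + k + 1) (fun e : S (n + k) => f e)
      (fun e : S (n + k) => (e : E)) (fun e => hf1 e e.2)
      (fun e => hR.mono (Nat.le_succ _) e.2) hf2.symm
    exact ⟨⟨f', hf'⟩, fun e he => hff ⟨e, he⟩⟩
  choose nx hnx using stp
  let fs : ∀ k, {f : E → E // Pr k f} := fun k => Nat.rec (motive := fun k => {f : E → E // Pr k f})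
    ⟨f0, hf0⟩ (fun k f => nx k f) k
  have hfs : ∀ k, ∀ e ∈ S (n + k), (fs (k + 1)).1 ((fs k).1 e) = e := fun k => hnx k (fs k)
  have hmap : ∀ k, ∀ e ∈ S (n + k), (fs k).1 e ∈ S (n + k + 1) := fun k => (fs k).2.1
  have hext : ∀ k, ∀ e ∈ S (n + k), (fs (k + 2)).1 e = (fs k).1 e := by
    intro k e he
    have h1 := hfs (k + 1) ((fs k).1 e) (hmap k e he)
    rwa [hfs k e he] at h1
  have hext2 : ∀ k d, ∀ e ∈ S (n + k), (fs (k + 2 * d)).1 e = (fs k).1 e := by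
    intro k d e he
    induction d with
    | zero => rfl
    | succ d ih =>
      rw [← ih]
      exact hext (k + 2 * d) e (hR.mono (by omega) he)
  choose κ hκ using hR.cover
  let τ : E → E := fun e => (fs (2 * κ e)).1 e
  let τ' : E → E := fun e => (fs (2 * κ e + 1)).1 e
  have hmono2 : ∀ {e i j}, e ∈ S i → i ≤ j → e ∈ S j := fun he hij => hR.mono hij he
  have hτ : ∀ k, ∀ e ∈ S (n + 2 * k), τ e = (fs (2 * k)).1 e := by
    intro k e he
    rcases le_total k (κ e) with h | h
    · obtain ⟨d, hd⟩ := Nat.exists_eq_add_of_le h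
      have := hext2 (2 * k) d e he
      simp only [τ]
      rw [← this]
      have e : 2 * κ e = 2 * k + 2 * d := by omega
      rw [e]
    · obtain ⟨d, hd⟩ := Nat.exists_eq_add_of_le h
      have := hext2 (2 * κ e) d e (hmono2 (hκ e) (by omega))
      simp only [τ]
      rw [← this]
      have e : 2 * k = 2 * κ e + 2 * d := by omega
      rw [e]
  have hτ' : ∀ k, ∀ e ∈ S (n + (2 * k + 1)), τ' e = (fs (2 * k + 1)).1 e := by
    intro k e he
    rcases le_total k (κ e) with h | h
    · obtain ⟨d, hd⟩ := Nat.exists_eq_add_of_le h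
      have := hext2 (2 * k + 1) d e he
      simp only [τ']
      rw [← this]
      have e : 2 * κ e + 1 = 2 * k + 1 + 2 * d := by omega
      rw [e]
    · obtain ⟨d, hd⟩ := Nat.exists_eq_add_of_le h
      have := hext2 (2 * κ e + 1) d e (hmono2 (hκ e) (by omega))
      simp only [τ']
      rw [← this]
      have e : 2 * k + 1 = 2 * κ e + 1 + 2 * d := by omega
      rw [e]
  have hl : ∀ e, τ' (τ e) = e := by
    intro e
    have he : e ∈ S (n + 2 * κ e) := hmono2 (hκ e) (by omega)
    rw [hτ _ e he, hτ' (κ e) _ (hmap _ e he)]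
    exact hfs _ e he
  have hr : ∀ e, τ (τ' e) = e := by
    intro e
    have he : e ∈ S (n + (2 * κ e + 1)) := hmono2 (hκ e) (by omega)
    have h2 : (fs (2 * κ e + 1)).1 e ∈ S (n + 2 * (κ e + 1)) := hmap _ e he
    rw [hτ' _ e he, hτ (κ e + 1) _ h2]
    exact hfs _ e he
  refine ⟨⟨τ, τ', hl, hr⟩, ?_, fun i => ?_⟩
  · change Elem L τ
    refine elem_of_local hR τ fun N => ⟨n + 2 * N, by omega, ?_⟩
    have : (fun e : S (n + 2 * N) => τ e) = fun e : S (n + 2 * N) => (fs (2 * N)).1 e := by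
      funext e; exact hτ N e e.2
    rw [this]
    exact (fs (2 * N)).2.2
  · change τ (a i) = b i
    rw [hτ 0 (a i) (ha i)]
    exact hf0a i

end PartC

/-! ### Part D: the amalgamation lemma -/

section PartD

open Filter
open scoped Pointwise

variable {L : Language.{u, v}} {E : Type w} [L.Structure E] {S : ℕ → Set E}

/-- automorphisms fixing `W` pointwise -/
def autW (L : Language.{u, v}) (E : Type w) [L.Structure E] (W : Set E) :
    Subgroup (Equiv.Perm E) where
  carrier := {τ | τ ∈ autG L E ∧ ∀ e ∈ W, τ e = e}
  mul_mem' := fun {a b} ha hb => ⟨mul_mem ha.1 hb.1, fun e he => by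
    rw [Equiv.Perm.mul_apply, hb.2 e he, ha.2 e he]⟩
  one_mem' := ⟨one_mem _, fun _ _ => rfl⟩
  inv_mem' := fun {a} ha => ⟨inv_mem ha.1, fun e he => by
    rw [Equiv.Perm.inv_eq_iff_eq, ha.2 e he]⟩

theorem perm_apply_inv {E : Type*} (τ : Equiv.Perm E) (e : E) : τ (τ⁻¹ e) = e :=
  Equiv.apply_symm_apply τ e

theorem perm_inv_apply {E : Type*} (τ : Equiv.Perm E) (e : E) : τ⁻¹ (τ e) = e :=
  Equiv.symm_apply_apply τ e

/-- the relation of a formula on maps -/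
def RR (θ : L.Formula (E ⊕ E)) (a b : E → E) : Prop := θ.Realize (Sum.elim a b)

theorem RR_auto (θ : L.Formula (E ⊕ E)) {h : Equiv.Perm E} (hh : h ∈ autG L E) (a b : E → E) :
    RR θ (fun e => h (a e)) (fun e => h (b e)) ↔ RR θ a b := by
  have := Elem.real (mem_autG.1 hh) θ (Sum.elim a b)
  unfold RR
  rw [← this]
  refine iff_of_eq (congrArg θ.Realize ?_)
  funext i; cases i <;> rfl

theorem RR_inv (W : Set E) (θ : L.Formula (E ⊕ E)) (h : autW L E W) (a b : E → E) :
    RR θ (h • a) (h • b) ↔ RR θ a b := RR_auto θ h.2.1 a b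

theorem RR_swap (θ : L.Formula (E ⊕ E)) (a b : E → E) :
    RR (θ.relabel Sum.swap) a b ↔ RR θ b a := realize_swap θ b a

theorem claimK (hR : Rich L E S) (hE : StableStr L E) (n : ℕ) {P : Type w} [L.Structure P]
    [Nonempty P] (j : P → E) (hj : Elem L j) (hjS : ∀ p, j p ∈ S n) (W : Set E)
    (hW : W ⊆ Set.range j) (g : autW L E W) (hg : ∀ p, (g : Equiv.Perm E) (j p) = j p)
    (θ : L.Formula (E ⊕ E)) (x : Ultrafilter (autW L E W))
    (hx : (MulAction.orbit (autW L E W) (DD (RR θ) (fun e : E => e) x)).Finite)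
    (k : autW L E W) :
    g • k • DD (RR θ) (fun e : E => e) x = k • DD (RR θ) (fun e : E => e) x := by
  classical
  obtain ⟨V, hV1, hV2⟩ := exists_UF (P := E) (E := P) (a := j) (b := fun p => p) hj.symm
  have hmono : ∀ N, S n ⊆ S (n + N) := fun N => hR.mono (Nat.le_add_right n N)
  have step : ∀ N, ∃ h : autW L E W, ∀ {γ δ : Type w} (θ : L.Formula (γ ⊕ δ))
      (a : γ → E) (b : δ → E), (∀ i, a i ∈ S (n + N)) → (∀ i, b i ∈ S (n + N)) →
      (θ.Realize (Sum.elim a (fun i => (h : Equiv.Perm E) (b i))) ↔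
        ∀ᶠ m in (V : Filter (E → P)), θ.Realize (Sum.elim a (fun i => j (m (b i))))) := by
    intro N
    obtain ⟨c, hc1, hc2⟩ := hR.real' (n + N) (V.map (fun m e => j (m e))) (by
      refine Filter.Eventually.of_forall (fun m => ?_) (f := (V : Filter (E → P)))
      intro e _
      exact hmono N (hjS _))
    have hcs : SameT L (fun e : S (n + N) => (e : E)) (fun e : S (n + N) => c e) := by
      intro ψ
      have h3 := hc2 (ψ.relabel (Sum.inr : S (n + N) → PEmpty.{w + 1} ⊕ S (n + N))) PEmpty.elim
        (fun e : S (n + N) => (e : E)) (fun i => i.elim) (fun i => i.2)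
      simp only [Formula.realize_relabel, Sum.elim_comp_inr] at h3
      rw [h3]
      change _ ↔ ∀ᶠ m in (V : Filter (E → P)), ψ.Realize (fun i : S (n + N) => j (m i))
      simp only [hj.real]
      have h4 := hV1 (ψ.relabel (fun e : S (n + N) => (e : E)))
      simp only [Formula.realize_relabel] at h4
      exact h4
    have hcK : ∀ p, c (j p) = j p := by
      intro p
      have h3 := hc2 (Term.equal (Term.var (Sum.inl PUnit.unit)) (Term.var (Sum.inr PUnit.unit)) :
        L.Formula (PUnit.{w + 1} ⊕ PUnit.{w + 1})) (fun _ => j p) (fun _ => j p)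
        (fun _ => hmono N (hjS p)) (fun _ => hmono N (hjS p))
      simp only [Formula.realize_equal, Term.realize_var, Sum.elim_inl, Sum.elim_inr] at h3
      refine (h3.2 ?_).symm
      change ∀ᶠ m in (V : Filter (E → P)), j p = j (m (j p))
      refine hV2.mono fun m hm => ?_
      rw [hm]
    obtain ⟨h, hh1, hh2⟩ := hR.homog (n + N + 1) (fun e : S (n + N) => (e : E))
      (fun e : S (n + N) => c e) (fun e => hR.mono (Nat.le_succ _) e.2) (fun e => hc1 e e.2) hcs
    refine ⟨⟨h, hh1, fun e he => ?_⟩, fun {γ δ} θ a b ha hb => ?_⟩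
    · obtain ⟨p, rfl⟩ := hW he
      rw [← hcK p]
      rw [hcK p]
      exact (hh2 ⟨j p, hmono N (hjS p)⟩).trans (hcK p)
    · have := hc2 θ a b ha hb
      have e1 : (fun i => c (b i)) = fun i => h (b i) := by
        funext i; exact (hh2 ⟨b i, hb i⟩).symm
      rw [e1] at this
      exact this
  choose h hh using step
  have lim1 : ∀ (θ : L.Formula (E ⊕ E)) (a b : E → E), ∀ᶠ N in (atTop : Filter ℕ),
      (RR θ a (h N • b) ↔ ∀ᶠ m in (V : Filter (E → P)), RR θ a (fun e => j (m (b e)))) := by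
    intro θ a b
    obtain ⟨s, θ', hs⟩ := fin_vars.{u, v, w} θ
    choose κ hκ using hR.cover
    let κ' : E ⊕ E → ℕ := fun i => κ (Sum.elim a b i)
    refine (eventually_ge_atTop (s.sup κ')).mono fun N hN => ?_
    have hmem : ∀ i ∈ s, Sum.elim a b i ∈ S (n + N) := fun i hi =>
      hR.mono (((Finset.le_sup (f := κ') hi).trans hN).trans (Nat.le_add_left _ _)) (hκ _)
    let γ := {e : E // Sum.inl e ∈ s}
    let δ := {e : E // Sum.inr e ∈ s}
    let ρ : s → γ ⊕ δ := fun i => match i with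
      | ⟨Sum.inl e, he⟩ => Sum.inl ⟨e, he⟩
      | ⟨Sum.inr e, he⟩ => Sum.inr ⟨e, he⟩
    have e1 : ∀ (f : E → E), RR θ a f ↔ (θ'.relabel ρ).Realize
        (Sum.elim (fun i : γ => a i) (fun i : δ => f i)) := by
      intro f
      rw [Formula.realize_relabel]
      refine (hs E _).trans (iff_of_eq (congrArg θ'.Realize ?_))
      funext ⟨i, hi⟩
      cases i <;> rfl
    simp only [e1]
    exact hh N (θ'.relabel ρ) (fun i : γ => a i) (fun i : δ => b i)
      (fun i => hmem (Sum.inl i) i.2) (fun i => hmem (Sum.inr i) i.2)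
  have lim2 : ∀ (θ : L.Formula (E ⊕ E)) (a b : E → E), ∀ᶠ N in (atTop : Filter ℕ),
      (RR θ a (g • h N • b) ↔ RR θ a (h N • b)) := by
    intro θ a b
    filter_upwards [lim1 θ (g⁻¹ • a) b, lim1 θ a b] with N h1 h2
    rw [h2, ← RR_inv W θ g⁻¹, inv_smul_smul, h1]
    refine Filter.eventually_congr (Filter.Eventually.of_forall fun m => ?_)
    rw [← RR_inv W θ g, smul_inv_smul]
    have : g • (fun e => j (m (b e))) = fun e => j (m (b e)) := by
      funext e; exact hg _
    rw [this]
  let 𝒟 : Ultrafilter ℕ := hyperfilter ℕ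
  have h𝒟 : (𝒟 : Filter ℕ) ≤ atTop := Nat.hyperfilter_le_atTop
  set D := DD (RR θ) (fun e : E => e) x with hD
  obtain ⟨π, hπ⟩ := ev_orbit (𝒟.map h) D hx
  have hπ : ∀ᶠ N in (𝒟 : Filter ℕ), ∀ C : MulAction.orbit (autW L E W) D, h N • C = π C := hπ
  have mem : ∀ (f : autW L E W) (z : E → E), z ∈ f • D ↔
      ∀ᶠ l in (x : Filter (autW L E W)), RR θ z (f • l • (fun e : E => e)) := by
    intro f z
    rw [Set.mem_smul_set_iff_inv_smul_mem]
    change (∀ᶠ l in (x : Filter (autW L E W)), RR θ _ _) ↔ _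
    refine Filter.eventually_congr (Filter.Eventually.of_forall fun l => ?_)
    rw [← RR_inv W θ f, smul_inv_smul]
  have comm : ∀ (g' f : autW L E W) (z : E → E),
      (∀ᶠ N in (𝒟 : Filter ℕ), z ∈ g' • h N • f • D) ↔
      ∀ᶠ l in (x : Filter (autW L E W)), ∀ᶠ N in (𝒟 : Filter ℕ),
        RR θ z (g' • h N • f • l • (fun e : E => e)) := by
    intro g' f z
    simp only [← mul_smul]
    simp only [mem]
    have nl1 := (hE.nl θ).comp (fun N : ℕ => (g' * h N)⁻¹ • z)
      (fun l : autW L E W => f • l • (fun e : E => e))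
    have nl2 := (hE.nl_op θ).comp (fun l : autW L E W => f • l • (fun e : E => e))
      (fun N : ℕ => (g' * h N)⁻¹ • z)
    have := lim_comm_iff nl1 nl2 𝒟 x
    have e : ∀ N (l : autW L E W), θ.Realize (Sum.elim ((g' * h N)⁻¹ • z) (f • l • (fun e : E => e)))
        ↔ RR θ z ((g' * h N * f * l) • (fun e : E => e)) := by
      intro N l
      change RR θ _ _ ↔ _
      rw [← RR_inv W θ (g' * h N), smul_inv_smul]
      simp only [mul_smul]
    simp only [e] at this
    simp only [mul_smul, mul_assoc] at this ⊢
    exact this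
  have main : ∀ f : autW L E W, ∀ᶠ N in (𝒟 : Filter ℕ), g • h N • f • D = h N • f • D := by
    intro f
    refine hπ.mono fun N hN => ?_
    have hNf : ∀ᶠ N' in (𝒟 : Filter ℕ), h N' • f • D = h N • f • D := by
      refine hπ.mono fun N' hN' => ?_
      have := (hN' ⟨f • D, f, rfl⟩).trans (hN ⟨f • D, f, rfl⟩).symm
      exact congrArg Subtype.val this
    ext z
    have c1 := comm g f z
    have c2 := comm 1 f z
    simp only [one_smul] at c2
    have c3 : (∀ᶠ l in (x : Filter (autW L E W)), ∀ᶠ N in (𝒟 : Filter ℕ),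
        RR θ z (g • h N • f • l • (fun e : E => e))) ↔
        (∀ᶠ l in (x : Filter (autW L E W)), ∀ᶠ N in (𝒟 : Filter ℕ),
        RR θ z (h N • f • l • (fun e : E => e))) :=
      Filter.eventually_congr (Filter.Eventually.of_forall fun l =>
        Filter.eventually_congr (h𝒟 (lim2 θ z _)))
    rw [← c1, ← c2] at c3
    have d1 : (∀ᶠ N' in (𝒟 : Filter ℕ), z ∈ g • h N' • f • D) ↔
        ∀ᶠ _N' in (𝒟 : Filter ℕ), z ∈ g • h N • f • D :=
      Filter.eventually_congr (hNf.mono fun N' hN' => by rw [hN'])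
    have d2 : (∀ᶠ N' in (𝒟 : Filter ℕ), z ∈ h N' • f • D) ↔
        ∀ᶠ _N' in (𝒟 : Filter ℕ), z ∈ h N • f • D :=
      Filter.eventually_congr (hNf.mono fun N' hN' => by rw [hN'])
    rw [d1, d2] at c3
    simpa using c3
  obtain ⟨N, hN⟩ := hπ.exists
  have := main ((h N)⁻¹ * k)
  obtain ⟨N', hN1, hN2⟩ := (this.and hπ).exists
  have e := (hN2 ⟨((h N)⁻¹ * k) • D, _, rfl⟩).trans (hN ⟨((h N)⁻¹ * k) • D, _, rfl⟩).symm
  have e' : h N' • ((h N)⁻¹ * k) • D = h N • ((h N)⁻¹ * k) • D := congrArg Subtype.val e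
  rw [e'] at hN1
  rw [mul_smul, smul_inv_smul] at hN1
  exact hN1

theorem star_r (hR : Rich L E S) (hE : StableStr L E) (n : ℕ) {P : Type w} [L.Structure P]
    [Nonempty P] (j : P → E) (hj : Elem L j) (hjS : ∀ p, j p ∈ S n) (W : Set E)
    (hW : W ⊆ Set.range j) (τ : Equiv.Perm E) (hτ : τ ∈ autG L E) (hτW : ∀ e, τ e ∈ W ↔ e ∈ W)
    (g : Equiv.Perm E) (hgE : g ∈ autG L E) (hg : ∀ p, g (j p) = j p) :
    ∃ x : Ultrafilter (autW L E W), ∀ θ : L.Formula (E ⊕ E),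
      (∀ᶠ h in (x : Filter (autW L E W)), ∀ᶠ l in (x : Filter (autW L E W)),
        RR θ (fun e => h.1 (τ e)) (fun e => l.1 (τ (g e)))) ↔
      (∀ᶠ h in (x : Filter (autW L E W)), ∀ᶠ l in (x : Filter (autW L E W)),
        RR θ (fun e => h.1 e) (fun e => l.1 e)) := by
  classical
  let z0 : E → E := fun e => e
  have hτW' : ∀ e, τ⁻¹ e ∈ W ↔ e ∈ W := fun e => by
    rw [← hτW, perm_apply_inv]
  obtain ⟨x, hx⟩ := exists_FO (H := autW L E W) (R := fun θ : L.Formula (E ⊕ E) => RR θ) z0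
    (fun θ => hE.nl_diff θ) (fun θ h a b => RR_inv W θ h a b)
  refine ⟨x, fun θ => ?_⟩
  let cj : autW L E W → autW L E W := fun h => ⟨τ⁻¹ * h * τ,
    mul_mem (mul_mem (inv_mem hτ) h.2.1) hτ, fun e he => by
      simp only [Equiv.Perm.mul_apply]
      rw [h.2.2 _ ((hτW e).2 he), perm_inv_apply]⟩
  let cj' : autW L E W → autW L E W := fun h => ⟨τ * h * τ⁻¹,
    mul_mem (mul_mem hτ h.2.1) (inv_mem hτ), fun e he => by
      simp only [Equiv.Perm.mul_apply]
      rw [h.2.2 _ ((hτW' e).2 he), perm_apply_inv]⟩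
  let x' := x.map cj
  let gW : autW L E W := ⟨g, hgE, fun e he => by
    obtain ⟨p, rfl⟩ := hW he
    exact hg p⟩
  have hx' : ∀ θ : L.Formula (E ⊕ E), (MulAction.orbit (autW L E W) (DD (RR θ) z0 x')).Finite := by
    intro θ
    let θ' := θ.relabel (Sum.map (fun e : E => e) τ)
    have hθ' : ∀ a b : E → E, RR θ' a b ↔ RR θ a (fun e => b (τ e)) := by
      intro a b
      simp only [RR, θ', Formula.realize_relabel, Sum.elim_comp_map]
      rfl
    refine ((hx θ').image (fun C => {a : E → E | (fun e => τ (a e)) ∈ C})).subset ?_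
    rintro _ ⟨h, rfl⟩
    refine ⟨cj' h • DD (RR θ') z0 x, ⟨cj' h, rfl⟩, ?_⟩
    ext a
    simp only [Set.mem_setOf_eq, Set.mem_smul_set_iff_inv_smul_mem]
    change (∀ᶠ l in (x : Filter (autW L E W)), RR θ' _ _) ↔
      ∀ᶠ l in (x : Filter (autW L E W)), RR θ _ (cj l • z0)
    refine Filter.eventually_congr (Filter.Eventually.of_forall fun l => ?_)
    rw [hθ', ← RR_auto θ hτ (h⁻¹ • a)]
    refine iff_of_eq ?_
    congr 1
    · funext e
      change (cj' h)⁻¹.1 (τ (a e)) = τ ((h⁻¹).1 (a e))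
      change (τ * h.1 * τ⁻¹)⁻¹ (τ (a e)) = τ (h.1⁻¹ (a e))
      rw [Equiv.Perm.inv_eq_iff_eq]
      simp
    · funext e
      change l.1 (τ e) = τ (τ⁻¹ (l.1 (τ e)))
      simp
  have nl1 := hE.nl θ
  have nl2 := hE.nl_op θ
  have hswap : ∀ y : Ultrafilter (autW L E W), DD (fun v u => RR θ u v) z0 y =
      DD (RR (θ.relabel Sum.swap)) z0 y := by
    intro y
    congr 1
    funext a b
    exact propext (RR_swap θ a b).symm
  have t1 := triv_r (z0 := z0) (R := RR θ) nl1 nl2 x' gW (by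
    intro k
    rw [hswap]
    exact claimK hR hE n j hj hjS W hW gW hg _ x' (hx' _) k)
  have t2 := uniq_r (z0 := z0) (R := RR θ) nl1 nl2 (RR_inv W θ) x' x
    (by rw [hswap]; exact hx' _) (hx θ)
  refine Iff.trans ?_ (t1.trans t2)
  change _ ↔ ∀ᶠ h in (x : Filter (autW L E W)), ∀ᶠ l in (x : Filter (autW L E W)),
    RR θ (cj h • z0) (cj l • gW • z0)
  refine Filter.eventually_congr (Filter.Eventually.of_forall fun h =>
    Filter.eventually_congr (Filter.Eventually.of_forall fun l => ?_))
  rw [← RR_auto θ (inv_mem hτ)]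
  rfl

theorem star (hR : Rich L E S) (hE : StableStr L E) (n : ℕ) {P : Type w} [L.Structure P]
    [Nonempty P] (j : P → E) (hj : Elem L j) (hjS : ∀ p, j p ∈ S n) (W : Set E)
    (hW : W ⊆ Set.range j) (τ : Equiv.Perm E) (hτ : τ ∈ autG L E) (hτW : ∀ e, τ e ∈ W ↔ e ∈ W)
    (g : Equiv.Perm E) (hgE : g ∈ autG L E) (hg : ∀ p, g (j p) = j p) :
    ∃ (E' : Type w) (_ : L.Structure E') (τ' : Equiv.Perm E') (j1 j2 : E → E'),
      τ' ∈ autG L E' ∧ Elem L j1 ∧ Elem L j2 ∧ (∀ e, j1 (τ e) = τ' (j1 e)) ∧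
      (∀ e, j2 ((τ * g) e) = τ' (j2 e)) ∧ ∀ e ∈ W, j1 e = j2 e := by
  classical
  have := hR.ne
  obtain ⟨x, hx⟩ := star_r hR hE n j hj hjS W hW τ hτ hτW g hgE hg
  let H := autW L E W
  let U := prodU x x
  let i1 : E → UP U E := fun e => UP.mk U (fun p => p.1.1 e)
  let i2 : E → UP U E := fun e => UP.mk U (fun p => p.2.1 e)
  have los2 : ∀ (a b : E → E) (θ : L.Formula (E ⊕ E)),
      θ.Realize (Sum.elim (fun e => i1 (a e)) (fun e => i2 (b e))) ↔
      (∀ᶠ h in (x : Filter H), ∀ᶠ l in (x : Filter H),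
        RR θ (fun e => h.1 (a e)) (fun e => l.1 (b e))) := by
    intro a b θ
    have := los U θ (Sum.elim (fun e p => p.1.1 (a e)) (fun e p => p.2.1 (b e)))
    have e1 : (fun i => UP.mk U ((Sum.elim (fun e p => p.1.1 (a e)) (fun e p => p.2.1 (b e)) :
        E ⊕ E → (H × H) → E) i)) = Sum.elim (fun e => i1 (a e)) (fun e => i2 (b e)) := by
      funext i; cases i <;> rfl
    have e2 : ∀ p : H × H, (fun i => (Sum.elim (fun e p => p.1.1 (a e)) (fun e p => p.2.1 (b e)) :
        E ⊕ E → (H × H) → E) i p) = Sum.elim (fun e => p.1.1 (a e)) (fun e => p.2.1 (b e)) := by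
      intro p; funext i; cases i <;> rfl
    rw [e1] at this
    refine this.trans (Iff.trans (Filter.eventually_congr (Filter.Eventually.of_forall fun p =>
      iff_of_eq (congrArg θ.Realize (e2 p)))) ?_)
    exact ev_prodU x x _
  have hi1 : Elem L i1 := by
    intro ψ
    rw [los]
    have e : ∀ p : H × H, ψ.Realize (fun e => p.1.1 e) ↔ ψ.Realize (fun e => e) := fun p =>
      Elem.real (mem_autG.1 p.1.2.1) ψ (fun e => e)
    refine Iff.trans ?_ (Filter.eventually_congr (Filter.Eventually.of_forall fun p =>
      (e p).symm))
    simp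
  have hi2 : Elem L i2 := by
    intro ψ
    rw [los]
    have e : ∀ p : H × H, ψ.Realize (fun e => p.2.1 e) ↔ ψ.Realize (fun e => e) := fun p =>
      Elem.real (mem_autG.1 p.2.2.1) ψ (fun e => e)
    refine Iff.trans ?_ (Filter.eventually_congr (Filter.Eventually.of_forall fun p =>
      (e p).symm))
    simp
  obtain ⟨E', _, S', f, hR', hf, hf0⟩ := exists_rich (L := L) (UP U E)
  have same : SameT L (Sum.elim i1 i2)
      (Sum.elim (fun e => i1 (τ e)) (fun e => i2 (τ (g e)))) := by
    intro θ
    have h1 := los2 (fun e => e) (fun e => e) θ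
    have h2 := los2 (fun e => τ e) (fun e => τ (g e)) θ
    exact (h1.trans (hx θ).symm).trans h2.symm
  have same' := ((hf.same (Sum.elim i1 i2)).symm.trans same).trans (hf.same _)
  obtain ⟨τ', hτ', hc⟩ := hR'.homog 0 _ _ (fun i => hf0 _) (fun i => hf0 _) same'
  refine ⟨E', inferInstance, τ', fun e => f (i1 e), fun e => f (i2 e), hτ', hf.comp hi1,
    hf.comp hi2, fun e => (hc (Sum.inl e)).symm, fun e => (hc (Sum.inr e)).symm, fun e he => ?_⟩
  change f (i1 e) = f (i2 e)
  congr 1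
  refine (UP.mk_eq U _ _).2 (Filter.Eventually.of_forall fun p => ?_)
  rw [p.1.2.2 e he, p.2.2.2 e he]

end PartD

/-! ### Part E: the expanded language -/

section PartE

open Filter

variable {L : Language.{u, v}}

/-- `E` as an `L⁺`-structure with `σ` interpreted by `τ` -/
def WA {E : Type w} (_τ : Equiv.Perm E) : Type w := E

instance {E : Type w} [h : L.Structure E] (τ : Equiv.Perm E) : L.Structure (WA τ) := h

instance {E : Type w} (τ : Equiv.Perm E) : sigmaLang.Structure (WA τ) where
  funMap := fun {n} (f : SigmaFunc n) => match n, f with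
    | _, SigmaFunc.sigma => fun x : Fin 1 → E => τ (x 0)
  RelMap := fun {n} (r : Empty) => r.elim

instance {E : Type w} [h : Nonempty E] (τ : Equiv.Perm E) : Nonempty (WA τ) := h

theorem sigmaMap_WA {E : Type w} [L.Structure E] (τ : Equiv.Perm E) (e : E) :
    sigmaMap L (WA τ) e = τ e := rfl

theorem models_Taut_iff (T : L.Theory) (X : Type w) [L.Structure X] [(LPlus L).Structure X]
    [(LHom.sumInl : L →ᴸ LPlus L).IsExpansionOn X] :
    X ⊨ Taut T ↔ X ⊨ T ∧ Function.Bijective (sigmaMap L X) ∧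
      (∀ (n : ℕ) (F : L.Functions n) (x : Fin n → X),
        sigmaMap L X (funMap F x) = funMap F (fun i => sigmaMap L X (x i))) ∧
      (∀ (n : ℕ) (R : L.Relations n) (x : Fin n → X),
        RelMap R x ↔ RelMap R (fun i => sigmaMap L X (x i))) := by
  have h1 : X ⊨ sigmaInj L ↔ Function.Injective (sigmaMap L X) := by
    simp only [sigmaInj, Sentence.Realize, Formula.Realize, BoundedFormula.realize_all,
      BoundedFormula.realize_imp, BoundedFormula.realize_bdEqual, sigmaTerm,
      Term.realize_functions_apply₁]
    rfl
  have h2 : X ⊨ sigmaSurj L ↔ Function.Surjective (sigmaMap L X) := by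
    simp only [sigmaSurj, Sentence.Realize, Formula.Realize, BoundedFormula.realize_all,
      BoundedFormula.realize_ex, BoundedFormula.realize_bdEqual, sigmaTerm,
      Term.realize_functions_apply₁]
    rfl
  have h3 : ∀ (n : ℕ) (F : L.Functions n), X ⊨ funCommSentence L F ↔ ∀ x : Fin n → X,
      sigmaMap L X (funMap F x) = funMap F (fun i => sigmaMap L X (x i)) := by
    intro n F
    simp only [funCommSentence, Sentence.Realize, BoundedFormula.realize_alls,
      BoundedFormula.realize_bdEqual, sigmaTerm, Term.realize_functions_apply₁]
    refine forall_congr' fun x => ?_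
    have a1 : ∀ (ts : Fin n → (LPlus L).Term (Empty ⊕ Fin n)) (v : Empty ⊕ Fin n → X),
        Term.realize v (Term.func (Sum.inl F : (LPlus L).Functions n) ts) =
          funMap F (fun i => (ts i).realize v) := fun ts v =>
      (LHom.sumInl : L →ᴸ LPlus L).map_onFunction F _
    rw [a1, a1]
    simp only [Term.realize_functions_apply₁]
    rfl
  have h4 : ∀ (n : ℕ) (R : L.Relations n), X ⊨ relPresSentence L R ↔ ∀ x : Fin n → X,
      (RelMap R x ↔ RelMap R (fun i => sigmaMap L X (x i))) := by
    intro n R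
    simp only [relPresSentence, Sentence.Realize, BoundedFormula.realize_alls,
      BoundedFormula.realize_iff, sigmaTerm]
    refine forall_congr' fun x => ?_
    have a1 : ∀ (ts : Fin n → (LPlus L).Term (Empty ⊕ Fin n)) (v : Empty → X),
        BoundedFormula.Realize (Relations.boundedFormula (Sum.inl R : (LPlus L).Relations n) ts)
          v x ↔ RelMap R (fun i => (ts i).realize (Sum.elim v x)) := fun ts v =>
      iff_of_eq ((LHom.sumInl : L →ᴸ LPlus L).map_onRelation R _)
    rw [a1, a1]
    simp only [Term.realize_functions_apply₁]
    rfl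
  simp only [Taut, Theory.model_union_iff, LHom.onTheory_model, and_assoc]
  refine and_congr Iff.rfl ?_
  simp only [Theory.model_iff, Set.mem_insert_iff, Set.mem_singleton_iff, Set.mem_setOf_eq,
    forall_eq_or_imp, forall_eq, h1, h2, Function.Bijective, and_assoc]
  refine and_congr Iff.rfl (and_congr Iff.rfl (and_congr ?_ ?_))
  · constructor
    · intro h n F
      exact (h3 n F).1 (h _ ⟨n, F, rfl⟩)
    · rintro h _ ⟨n, F, rfl⟩
      exact (h3 n F).2 (h n F)
  · constructor
    · intro h n R
      exact (h4 n R).1 (h _ ⟨n, R, rfl⟩)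
    · rintro h _ ⟨n, R, rfl⟩
      exact (h4 n R).2 (h n R)

theorem WA_model {T : L.Theory} {E : Type w} [L.Structure E] (hT : E ⊨ T) (τ : Equiv.Perm E)
    (hτ : τ ∈ autG L E) : WA τ ⊨ Taut T := by
  rw [models_Taut_iff]
  refine ⟨hT, τ.bijective, fun n F x => ?_, fun n R x => ?_⟩
  · exact (mem_autG.1 hτ).funMap F x
  · exact ((mem_autG.1 hτ).relMap R x).symm

theorem sigma_elem (T : L.Theory) (X : Type w) [L.Structure X] [(LPlus L).Structure X]
    [(LHom.sumInl : L →ᴸ LPlus L).IsExpansionOn X] (h : X ⊨ Taut T) :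
    Elem L (sigmaMap L X) := by
  rw [models_Taut_iff] at h
  obtain ⟨_, hb, hF, hR⟩ := h
  let e : X ≃[L] X :=
    { Equiv.ofBijective _ hb with
      map_fun' := fun {n} F x => hF n F x
      map_rel' := fun {n} R x => (hR n R x).symm }
  intro ψ
  exact (StrongHomClass.realize_formula e ψ).symm

/-- Embeddings of `L⁺`-structures. -/
def mkEmb {X Y : Type*} [(LPlus L).Structure X] [(LPlus L).Structure Y] (f : X → Y)
    (hi : Function.Injective f)
    (hF : ∀ (n : ℕ) (F : L.Functions n) (x : Fin n → X),
      f (funMap (L := LPlus L) (Sum.inl F) x) =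
        funMap (L := LPlus L) (Sum.inl F) (fun i => f (x i)))
    (hR : ∀ (n : ℕ) (R : L.Relations n) (x : Fin n → X),
      RelMap (L := LPlus L) (Sum.inl R) (fun i => f (x i)) ↔
        RelMap (L := LPlus L) (Sum.inl R) x)
    (hσ : ∀ x, f (sigmaMap L X x) = sigmaMap L Y (f x)) : X ↪[LPlus L] Y where
  toFun := f
  inj' := hi
  map_fun' := fun {n} F x => by
    rcases F with F | F
    · exact hF n F x
    · cases F
      have e1 : x = ![x 0] := by funext i; rw [Subsingleton.elim i 0]; rfl
      have e2 : f ∘ x = ![f (x 0)] := by funext i; rw [Subsingleton.elim i 0]; rfl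
      rw [e2]
      conv_lhs => rw [e1]
      exact hσ (x 0)
  map_rel' := fun {n} R x => by
    rcases R with R | R
    · exact hR n R x
    · exact (R : Empty).elim

/-- an elementary map commuting with automorphisms -/
def elemEmb {X Y : Type w} [L.Structure X] [L.Structure Y] {τ : Equiv.Perm X} {τ' : Equiv.Perm Y}
    (f : X → Y) (hf : Elem L f) (h : ∀ x, f (τ x) = τ' (f x)) : WA τ ↪[LPlus L] WA τ' :=
  mkEmb (X := WA τ) (Y := WA τ') f hf.inj (fun _ F x => hf.funMap F x) (fun _ R x => hf.relMap R x) h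

/-- expand an embedding by constants -/
def embConst {L' : Language.{u, v}} {X Y : Type w} [L'.Structure X] [L'.Structure Y]
    (e : X ↪[L'] Y) : letI : (constantsOn X).Structure Y := constantsOn.structure e
    X ↪[L'[[X]]] Y :=
  letI : (constantsOn X).Structure Y := constantsOn.structure e
  { toFun := e
    inj' := e.injective
    map_fun' := fun {n} F x => by
      rcases F with F | F
      · exact e.map_fun F x
      · match n, F with
        | 0, c => rfl
    map_rel' := fun {n} R x => by
      rcases R with R | R
      · exact e.map_rel R x
      · exact isEmptyElim R }

theorem tr_aux {L' : Language.{u, v}} {S Tmc : L'.Theory}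
    (hmc : IsModelCompletion.{u, v, w} S Tmc) (X : Theory.ModelType.{u, v, w} S)
    (φ : (L'[[X]]).Sentence) :
    (∀ (N : Theory.ModelType.{u, v, w} Tmc) (e : X ↪[L'] N),
      letI : (constantsOn X).Structure N := constantsOn.structure e; (N : Type w) ⊨ φ) ∨
    (∀ (N : Theory.ModelType.{u, v, w} Tmc) (e : X ↪[L'] N),
      letI : (constantsOn X).Structure N := constantsOn.structure e; (N : Type w) ⊨ ∼φ) := by
  have key : ∀ (N : Theory.ModelType.{u, v, w} Tmc) (e : X ↪[L'] N),
      letI : (constantsOn X).Structure N := constantsOn.structure e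
      (N : Type w) ⊨ ((L'.lhomWithConstants X).onTheory Tmc ∪ atomicDiagram L' X) := by
    intro N e
    letI : (constantsOn X).Structure N := constantsOn.structure e
    have hat : ∀ ψ : (L'[[X]]).Sentence, ψ.IsAtomic → ((N : Type w) ⊨ ψ ↔ (X : Type w) ⊨ ψ) := by
      intro ψ hψ
      have := hψ.isQF.realize_embedding (embConst e) (v := (default : Empty → X))
        (xs := (default : Fin 0 → X))
      unfold Sentence.Realize Formula.Realize
      rw [← this]
      rw [Subsingleton.elim (⇑(embConst e) ∘ (default : Empty → X)) default,
        Subsingleton.elim (⇑(embConst e) ∘ (default : Fin 0 → X)) default]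
    rw [Theory.model_union_iff]
    refine ⟨(LHom.onTheory_model _ _).2 N.is_model, ?_⟩
    rw [Theory.model_iff]
    rintro ψ ⟨h | ⟨ψ', h, rfl⟩, h2⟩
    · exact (hat ψ h).2 h2
    · rw [Sentence.realize_not] at h2 ⊢
      rwa [hat ψ' h]
  rcases (hmc.2.2 X).2 φ with h | h
  · refine Or.inl fun N e => ?_
    letI : (constantsOn X).Structure N := constantsOn.structure e
    have := key N e
    exact h.realize_sentence N
  · refine Or.inr fun N e => ?_
    letI : (constantsOn X).Structure N := constantsOn.structure e
    have := key N e
    exact h.realize_sentence N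

theorem tr_uniq {L' : Language.{u, v}} {S Tmc : L'.Theory}
    (hmc : IsModelCompletion.{u, v, w} S Tmc) (X : Theory.ModelType.{u, v, w} S)
    (N1 N2 : Theory.ModelType.{u, v, w} Tmc) (e1 : X ↪[L'] N1) (e2 : X ↪[L'] N2)
    {γ : Type*} (χ : L'.Formula γ) (v : γ → X) :
    χ.Realize (fun i => e1 (v i)) ↔ χ.Realize (fun i => e2 (v i)) := by
  have key : ∀ (N : Theory.ModelType.{u, v, w} Tmc) (e : X ↪[L'] N),
      letI : (constantsOn X).Structure N := constantsOn.structure e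
      ((N : Type w) ⊨ Formula.equivSentence (χ.relabel v) ↔ χ.Realize (fun i => e (v i))) := by
    intro N e
    letI : (constantsOn X).Structure N := constantsOn.structure e
    rw [Formula.realize_equivSentence, Formula.realize_relabel]
    rfl
  have k1 := key N1 e1
  have k2 := key N2 e2
  rcases tr_aux hmc X (Formula.equivSentence (χ.relabel v)) with h | h
  · exact ⟨fun _ => k2.1 (h N2 e2), fun _ => k1.1 (h N1 e1)⟩
  · refine ⟨fun h1 => ?_, fun h2 => ?_⟩
    · have := h N1 e1
      rw [Sentence.realize_not] at this
      exact absurd (k1.2 h1) this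
    · have := h N2 e2
      rw [Sentence.realize_not] at this
      exact absurd (k2.2 h2) this

/-- truth in the model companion -/
def Tr {L' : Language.{u, v}} (Tmc : L'.Theory) (X : Type w) [L'.Structure X] {γ : Type*}
    (χ : L'.Formula γ) (v : γ → X) : Prop :=
  ∀ (N : Theory.ModelType.{u, v, w} Tmc) (e : X ↪[L'] N), χ.Realize (fun i => e (v i))

section Tr

variable {L' : Language.{u, v}} {S Tmc : L'.Theory} (hmc : IsModelCompletion.{u, v, w} S Tmc)
  {X Y : Type w} [L'.Structure X] [L'.Structure Y] {γ : Type*}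

theorem Tr_iff [Nonempty X] (hmc : IsModelCompletion.{u, v, w} S Tmc) (hX : X ⊨ S)
    (N : Theory.ModelType.{u, v, w} Tmc) (e : X ↪[L'] N) (χ : L'.Formula γ) (v : γ → X) :
    Tr Tmc X χ v ↔ χ.Realize (fun i => e (v i)) :=
  ⟨fun h => h N e, fun h N' e' => (tr_uniq hmc ⟨X⟩ N' N e' e χ v).2 h⟩

theorem Tr_emb [Nonempty X] [Nonempty Y] (hmc : IsModelCompletion.{u, v, w} S Tmc) (hX : X ⊨ S)
    (hY : Y ⊨ S) (e : X ↪[L'] Y) (χ : L'.Formula γ) (v : γ → X) :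
    Tr Tmc X χ v ↔ Tr Tmc Y χ (fun i => e (v i)) := by
  obtain ⟨N, ⟨f⟩⟩ := hmc.2.1 ⟨Y⟩
  rw [Tr_iff hmc hX N (f.comp e), Tr_iff hmc hY N f]
  rfl

theorem Tr_model [Nonempty X] (hmc : IsModelCompletion.{u, v, w} S Tmc) (hX : X ⊨ Tmc)
    (χ : L'.Formula γ) (v : γ → X) : Tr Tmc X χ v ↔ χ.Realize v :=
  Tr_iff hmc (hX.mono hmc.1) ⟨X⟩ (Embedding.refl L' X) χ v

end Tr

variable {T : L.Theory} {Tmc : (LPlus L).Theory}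

theorem star_Tr (hmc : IsModelCompletion.{u, v, w} (Taut T) Tmc)
    {E : Type w} [L.Structure E] {S : ℕ → Set E} (hR : Rich L E S) (hE : StableStr L E)
    (hT : E ⊨ T) (n : ℕ) {P : Type w} [L.Structure P]
    [Nonempty P] (j : P → E) (hj : Elem L j) (hjS : ∀ p, j p ∈ S n) (W : Set E)
    (hW : W ⊆ Set.range j) (τ : Equiv.Perm E) (hτ : τ ∈ autG L E) (hτW : ∀ e, τ e ∈ W ↔ e ∈ W)
    (g : Equiv.Perm E) (hgE : g ∈ autG L E) (hg : ∀ p, g (j p) = j p)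
    {γ : Type*} (χ : (LPlus L).Formula γ) (v : γ → E) (hv : ∀ i, v i ∈ W) :
    Tr Tmc (WA (τ * g)) χ v ↔ Tr Tmc (WA τ) χ v := by
  have := hR.ne
  obtain ⟨E', _, τ', j1, j2, hτ', h1, h2, hc1, hc2, hc⟩ :=
    star hR hE n j hj hjS W hW τ hτ hτW g hgE hg
  have hT' : E' ⊨ T := by
    rw [Theory.model_iff] at hT ⊢
    intro φ hφ
    exact (h1.sentence φ).1 (hT φ hφ)
  have : Nonempty E' := ⟨j1 (Classical.choice hR.ne)⟩
  have m' := WA_model hT' τ' hτ'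
  have q1 := Tr_emb hmc (WA_model hT _ (mul_mem hτ hgE)) m' (elemEmb j2 h2 hc2) χ v
  have q2 := Tr_emb hmc (WA_model hT _ hτ) m' (elemEmb j1 h1 hc1) χ v
  refine q1.trans (Iff.trans (iff_of_eq ?_) q2.symm)
  congr 1
  funext i
  exact (hc _ (hv i)).symm

/-- the version with multiplication from the left -/
theorem star_Tr_left (hmc : IsModelCompletion.{u, v, w} (Taut T) Tmc)
    {E : Type w} [L.Structure E] {S : ℕ → Set E} (hR : Rich L E S) (hE : StableStr L E)
    (hT : E ⊨ T) (n : ℕ) {P : Type w} [L.Structure P]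
    [Nonempty P] (j : P → E) (hj : Elem L j) (hjS : ∀ p, j p ∈ S n) (W : Set E)
    (hW : W ⊆ Set.range j) (τ : Equiv.Perm E) (hτ : τ ∈ autG L E) (hτW : ∀ e, τ e ∈ W ↔ e ∈ W)
    (g : Equiv.Perm E) (hgE : g ∈ autG L E) (hg : ∀ p, g (j p) = j p)
    {γ : Type*} (χ : (LPlus L).Formula γ) (v : γ → E) (hv : ∀ i, v i ∈ W) :
    Tr Tmc (WA (g * τ)) χ v ↔ Tr Tmc (WA τ) χ v := by
  have := hR.ne
  rw [← star_Tr hmc hR hE hT n j hj hjS W hW τ hτ hτW g hgE hg χ v hv]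
  have hc : ∀ x, g ((τ * g) x) = (g * τ) (g x) := fun x => rfl
  have q := Tr_emb hmc (WA_model hT _ (mul_mem hτ hgE)) (WA_model hT _ (mul_mem hgE hτ))
    (elemEmb g hgE hc) χ v
  refine Iff.trans (iff_of_eq ?_) q.symm
  congr 1
  funext i
  obtain ⟨p, hp⟩ := hW (hv i)
  change v i = g (v i)
  rw [← hp, hg]

end PartE

/-! ### Part F: iterated limits -/

section PartF

open Filter Function

variable {L : Language.{u, v}}

/-- iterated limits along a list of coordinates -/
noncomputable def itU : List ℕ → (ℕ → ℕ) → Ultrafilter (ℕ → ℕ)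
  | [], s => pure s
  | v :: l, s => (hyperfilter ℕ).bind (fun t => itU l (update s v t))

theorem itU_nil (s : ℕ → ℕ) (p : (ℕ → ℕ) → Prop) :
    (∀ᶠ q in (itU [] s : Filter (ℕ → ℕ)), p q) ↔ p s := Iff.rfl

theorem itU_cons (v : ℕ) (l : List ℕ) (s : ℕ → ℕ) (p : (ℕ → ℕ) → Prop) :
    (∀ᶠ q in (itU (v :: l) s : Filter (ℕ → ℕ)), p q) ↔
      ∀ᶠ t in (hyperfilter ℕ : Filter ℕ),
        ∀ᶠ q in (itU l (update s v t) : Filter (ℕ → ℕ)), p q := Iff.rfl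

theorem itU_app (l l' : List ℕ) (s : ℕ → ℕ) (p : (ℕ → ℕ) → Prop) :
    (∀ᶠ q in (itU (l ++ l') s : Filter (ℕ → ℕ)), p q) ↔
      ∀ᶠ s' in (itU l s : Filter (ℕ → ℕ)), ∀ᶠ q in (itU l' s' : Filter (ℕ → ℕ)), p q := by
  induction l generalizing s with
  | nil => rw [itU_nil]; rfl
  | cons v l ih =>
    rw [List.cons_append, itU_cons, itU_cons]
    exact Filter.eventually_congr (Filter.Eventually.of_forall fun t => ih _)

theorem itU_fix (l : List ℕ) (v : ℕ) (hv : v ∉ l) (s : ℕ → ℕ) :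
    ∀ᶠ q in (itU l s : Filter (ℕ → ℕ)), q v = s v := by
  induction l generalizing s with
  | nil => rw [itU_nil]
  | cons u l ih =>
    rw [itU_cons]
    refine Filter.Eventually.of_forall fun t => ?_
    rw [List.mem_cons, not_or] at hv
    have := ih hv.2 (update s u t)
    rwa [update_of_ne hv.1] at this

theorem itU_upd (l : List ℕ) (v : ℕ) (hv : v ∉ l) (s : ℕ → ℕ) (t : ℕ) (p : (ℕ → ℕ) → Prop) :
    (∀ᶠ q in (itU l (update s v t) : Filter (ℕ → ℕ)), p q) ↔
      ∀ᶠ q in (itU l s : Filter (ℕ → ℕ)), p (update q v t) := by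
  induction l generalizing s with
  | nil => rw [itU_nil, itU_nil]
  | cons u l ih =>
    rw [itU_cons, itU_cons]
    rw [List.mem_cons, not_or] at hv
    refine Filter.eventually_congr (Filter.Eventually.of_forall fun t' => ?_)
    rw [update_comm hv.1]
    exact ih hv.2 _

theorem itU_big (l : List ℕ) (v : ℕ) (hv : v ∈ l) (s : ℕ → ℕ) (T : ℕ) :
    ∀ᶠ q in (itU l s : Filter (ℕ → ℕ)), T < q v := by
  induction l generalizing s with
  | nil => simp at hv
  | cons u l ih =>
    rw [itU_cons]
    by_cases h : v ∈ l
    · exact Filter.Eventually.of_forall fun t => ih h _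
    · have hu : v = u := by
        rcases List.mem_cons.1 hv with h' | h'
        · exact h'
        · exact absurd h' h
      subst hu
      have h1 : ∀ᶠ t in (hyperfilter ℕ : Filter ℕ), T < t :=
        Nat.hyperfilter_le_atTop (eventually_gt_atTop T)
      refine h1.mono fun t ht => (itU_fix l v h _).mono fun q hq => ?_
      rw [hq, update_self]
      exact ht

theorem itU_lt (p q : List ℕ) (a b : ℕ) (ha : a ∉ q) (hb : b ∈ q) (s : ℕ → ℕ) :
    ∀ᶠ x in (itU (p ++ a :: q) s : Filter (ℕ → ℕ)), x a < x b := by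
  rw [itU_app]
  refine Filter.Eventually.of_forall fun s' => ?_
  rw [itU_cons]
  refine Filter.Eventually.of_forall fun t => ?_
  filter_upwards [itU_fix q a ha (update s' a t), itU_big q b hb (update s' a t) t] with x h1 h2
  rw [h1, update_self]
  exact h2

/-- `F` only depends on the coordinates in `C` -/
def Dep {M : Type*} (C : Set ℕ) (F : (ℕ → ℕ) → M) : Prop :=
  ∀ s s' : ℕ → ℕ, (∀ c ∈ C, s c = s' c) → F s = F s'

theorem Dep.upd {M : Type*} {C : Set ℕ} {F : (ℕ → ℕ) → M} (h : Dep C F) {v : ℕ} (hv : v ∉ C)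
    (s : ℕ → ℕ) (t : ℕ) : F (update s v t) = F s :=
  h _ _ fun c hc => update_of_ne (by rintro rfl; exact hv hc) _ _

theorem Dep.mono {M : Type*} {C C' : Set ℕ} {F : (ℕ → ℕ) → M} (h : Dep C F) (hC : C ⊆ C') :
    Dep C' F := fun s s' hs => h s s' fun c hc => hs c (hC hc)

theorem Dep.map {M M' : Type*} {C : Set ℕ} {F : (ℕ → ℕ) → M} (h : Dep C F) (f : M → M') :
    Dep C (fun s => f (F s)) := fun s s' hs => congrArg f (h s s' hs)

theorem itU_swap {M : Type w} [L.Structure M] [Nonempty M]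
    (hst : ∀ U : Ultrafilter (ℕ → ℕ), StableStr L (UP U M)) (p q : List ℕ) (a b : ℕ)
    (hab : a ≠ b) (ha : a ∉ q) (hb : b ∉ q) (s : ℕ → ℕ) {γ : Type*} (ψ : L.Formula γ)
    (F : γ → (ℕ → ℕ) → M) (hF : ∀ g, Dep {a}ᶜ (F g) ∨ Dep {b}ᶜ (F g)) :
    (∀ᶠ x in (itU (p ++ a :: b :: q) s : Filter (ℕ → ℕ)), ψ.Realize (fun g => F g x)) ↔
    (∀ᶠ x in (itU (p ++ b :: a :: q) s : Filter (ℕ → ℕ)), ψ.Realize (fun g => F g x)) := by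
  classical
  rw [itU_app, itU_app]
  refine Filter.eventually_congr (Filter.Eventually.of_forall fun s' => ?_)
  simp only [itU_cons]
  let U := itU q s'
  let X : ℕ → γ → UP U M := fun t g => UP.mk U (fun x => F g (update x a t))
  let Y : ℕ → γ → UP U M := fun t g => UP.mk U (fun x => F g (update x b t))
  let ρ : γ → γ ⊕ γ := fun g => if Dep {a}ᶜ (F g) then Sum.inr g else Sum.inl g
  have e0 : ∀ t t', (∀ᶠ x in (itU q (update (update s' a t) b t') : Filter (ℕ → ℕ)),
      ψ.Realize (fun g => F g x)) ↔ (ψ.relabel ρ).Realize (Sum.elim (X t) (Y t')) := by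
    intro t t'
    rw [itU_upd q b hb, itU_upd q a ha, Formula.realize_relabel]
    have : Sum.elim (X t) (Y t') ∘ ρ =
        fun g => UP.mk U (fun x => F g (update (update x a t) b t')) := by
      funext g
      by_cases h : Dep {a}ᶜ (F g)
      · simp only [comp_apply, ρ, h, if_true, Sum.elim_inr, Y]
        congr 1
        funext x
        have hm : a ∉ ({a}ᶜ : Set ℕ) := by simp
        rw [update_comm hab]
        exact (h.upd hm (update x b t') t).symm
      · have h' : Dep {b}ᶜ (F g) := (hF g).resolve_left h
        simp only [comp_apply, ρ, h, if_false, Sum.elim_inl, X]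
        congr 1
        funext x
        have hm : b ∉ ({b}ᶜ : Set ℕ) := by simp
        exact (h'.upd hm (update x a t) t').symm
    rw [this, los]
  have e1 : ∀ t t', (∀ᶠ x in (itU q (update (update s' b t) a t') : Filter (ℕ → ℕ)),
      ψ.Realize (fun g => F g x)) ↔ (ψ.relabel ρ).Realize (Sum.elim (X t') (Y t)) := by
    intro t t'
    rw [update_comm hab.symm]
    exact e0 t' t
  simp only [e0, e1]
  exact lim_comm_iff (((hst U).nl (ψ.relabel ρ)).comp X Y) (((hst U).nl_op (ψ.relabel ρ)).comp Y X)
    (hyperfilter ℕ) (hyperfilter ℕ)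

/-- the list of coordinates with `0` at position `k` -/
def lst (n k : ℕ) : List ℕ := List.range' 1 k ++ 0 :: List.range' (k + 1) (n - k)

/-- the associated iterated limit -/
noncomputable def UU (n k : ℕ) : Ultrafilter (ℕ → ℕ) := itU (lst n k) 0

theorem UU_swap {M : Type w} [L.Structure M] [Nonempty M]
    (hst : ∀ U : Ultrafilter (ℕ → ℕ), StableStr L (UP U M)) {n k : ℕ} (hk : k < n)
    {γ : Type*} (ψ : L.Formula γ)
    (F : γ → (ℕ → ℕ) → M) (hF : ∀ g, Dep {0}ᶜ (F g) ∨ Dep {k + 1}ᶜ (F g)) :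
    (∀ᶠ x in (UU n k : Filter (ℕ → ℕ)), ψ.Realize (fun g => F g x)) ↔
    (∀ᶠ x in (UU n (k + 1) : Filter (ℕ → ℕ)), ψ.Realize (fun g => F g x)) := by
  have h1 : lst n k = List.range' 1 k ++ 0 :: (k + 1) :: List.range' (k + 2) (n - (k + 1)) := by
    unfold lst
    obtain ⟨m, hm⟩ : ∃ m, n - k = m + 1 := ⟨n - k - 1, by omega⟩
    have : n - (k + 1) = m := by omega
    rw [hm, this, List.range'_succ]
  have h2 : lst n (k + 1) =
      List.range' 1 k ++ (k + 1) :: 0 :: List.range' (k + 2) (n - (k + 1)) := by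
    unfold lst
    rw [List.range'_1_concat, List.append_assoc, add_comm 1 k]
    rfl
  unfold UU
  rw [h1, h2]
  exact itU_swap hst _ _ 0 (k + 1) (by omega) (by simp) (by simp) _ ψ F hF

theorem UU_lt_of_le {n k i : ℕ} (h1 : 1 ≤ i) (h2 : i ≤ k) :
    ∀ᶠ x in (UU n k : Filter (ℕ → ℕ)), x i < x 0 := by
  have : lst n k = List.range' 1 (i - 1) ++ i ::
      (List.range' (i + 1) (k - i) ++ 0 :: List.range' (k + 1) (n - k)) := by
    unfold lst
    rw [← List.cons_append, ← List.append_assoc]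
    congr 1
    have : i :: List.range' (i + 1) (k - i) = List.range' i (k - i + 1) := by
      rw [List.range'_succ]
    rw [this]
    have e : i = 1 + (i - 1) := by omega
    conv_rhs => rw [e]
    have := List.range'_append_1 (s := 1) (m := 1 + (i - 1) - 1) (n := k - (1 + (i - 1)) + 1)
    rw [← e] at this ⊢
    rw [← e] at this
    rw [this]
    congr 1
    omega
  unfold UU
  rw [this]
  refine itU_lt _ _ i 0 ?_ ?_ _
  · simp; omega
  · simp

theorem UU_lt_of_gt {n k i : ℕ} (h1 : k < i) (h2 : i ≤ n) :
    ∀ᶠ x in (UU n k : Filter (ℕ → ℕ)), x 0 < x i := by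
  unfold UU lst
  refine itU_lt _ _ 0 i ?_ ?_ _
  · simp
  · simp; omega

end PartF

/-! ### Part G: the configuration -/

section PartG

open Filter Function

variable {L : Language.{u, v}}

/-- lift of a map on sequences to the ultrapower -/
noncomputable def liftUP {I : Type*} (U : Ultrafilter I) {M E : Type*} (f : (I → M) → E) :
    UP U M → E := fun p => f (Classical.choose (UP.mk_surj U p))

theorem liftUP_mk {I : Type*} {U : Ultrafilter I} {M E : Type*} [L.Structure M] [Nonempty M]
    [L.Structure E] {f : (I → M) → E} (h : SameT L (fun F => UP.mk U F) f) (F : I → M) :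
    liftUP U f (UP.mk U F) = f F :=
  (h.eq_iff _ _).1 (Classical.choose_spec (UP.mk_surj U (UP.mk U F)))

theorem liftUP_elem {I : Type*} {U : Ultrafilter I} {M E : Type*} [L.Structure M] [Nonempty M]
    [L.Structure E] {f : (I → M) → E} (h : SameT L (fun F => UP.mk U F) f) :
    Elem L (liftUP U f) := by
  have := h.comp (fun p : UP U M => Classical.choose (UP.mk_surj U p))
  have e : (fun p : UP U M => UP.mk U (Classical.choose (UP.mk_surj U p))) = fun p => p :=
    funext fun p => Classical.choose_spec (UP.mk_surj U p)
  rw [e] at this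
  exact this

theorem same_los {I : Type*} {U : Ultrafilter I} {M E : Type*} [L.Structure M] [Nonempty M]
    [L.Structure E] {f : (I → M) → E} (h : SameT L (fun F => UP.mk U F) f) {γ : Type*}
    (ψ : L.Formula γ) (F : γ → I → M) :
    ψ.Realize (fun g => f (F g)) ↔ ∀ᶠ s in (U : Filter I), ψ.Realize (fun g => F g s) :=
  (h.comp F ψ).symm.trans (los U ψ F)

theorem same_map {I : Type*} {U : Ultrafilter I} {M E : Type*} [L.Structure M] [Nonempty M]
    [L.Structure E] {f : (I → M) → E} (h : SameT L (fun F => UP.mk U F) f) (r : I → I) :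
    SameT L (fun F => UP.mk (U.map r) F) (fun F => f (fun s => F (r s))) := by
  intro ψ
  rw [los, same_los h]
  rfl

theorem exists_conf0 {M : Type w} [L.Structure M] [Nonempty M]
    (hst : ∀ U : Ultrafilter (ℕ → ℕ), StableStr L (UP U M)) (n : ℕ) (m : ℕ) (hm : m ≤ n) :
    ∃ (E : Type w) (_ : L.Structure E) (_ : Nonempty E) (j : ℕ → ((ℕ → ℕ) → M) → E),
      (∀ k ≤ m, SameT L (fun F => UP.mk (UU n k) F) (j k)) ∧
      (∀ k < m, ∀ F, (Dep {0}ᶜ F ∨ Dep {k + 1}ᶜ F) → j k F = j (k + 1) F) := by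
  induction m with
  | zero =>
    refine ⟨UP (UU n 0) M, inferInstance, inferInstance, fun _ F => UP.mk _ F, ?_, ?_⟩
    · intro k hk
      obtain rfl : k = 0 := by omega
      exact fun _ => Iff.rfl
    · intro k hk
      omega
  | succ m ih =>
    obtain ⟨E, _, _, j, h1, h2⟩ := ih (by omega)
    have hs : SameT L
        (fun F : {F : (ℕ → ℕ) → M // Dep {0}ᶜ F ∨ Dep {m + 1}ᶜ F} => UP.mk (UU n (m + 1)) F.1)
        (fun F : {F : (ℕ → ℕ) → M // Dep {0}ᶜ F ∨ Dep {m + 1}ᶜ F} => j m F.1) := by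
      intro ψ
      rw [los, same_los (h1 m le_rfl)]
      exact (UU_swap hst (by omega) ψ _ (fun F => F.2)).symm
    obtain ⟨E', _, _, f, g, hf, hg, hfg⟩ := amalg hs
    refine ⟨E', inferInstance, inferInstance,
      fun k F => if k ≤ m then f (j k F) else g (UP.mk (UU n (m + 1)) F), ?_, ?_⟩
    · intro k hk
      by_cases hkm : k ≤ m
      · simp only [hkm, if_true]
        exact (h1 k hkm).trans (hf.same _)
      · obtain rfl : k = m + 1 := by omega
        simp only [hkm, if_false]
        exact hg.same _
    · intro k hk F hF
      have hkm : k ≤ m := by omega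
      simp only [hkm, if_true]
      by_cases hk2 : k + 1 ≤ m
      · simp only [hk2, if_true]
        rw [h2 k hk2 F hF]
      · simp only [hk2, if_false]
        obtain rfl : k = m := by omega
        exact (hfg ⟨F, hF⟩).symm

/-- the configuration of copies of ultrapowers -/
structure Conf (L : Language.{u, v}) {M : Type w} [L.Structure M]
    (σ : Equiv.Perm M) (n : ℕ) (E : Type w) [L.Structure E] (S : ℕ → Set E)
    (j : ℕ → ((ℕ → ℕ) → M) → E) (sg : ℕ → Equiv.Perm E) : Prop where
  rich : Rich L E S
  inS : ∀ k ≤ n, ∀ F, j k F ∈ S 0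
  los : ∀ k ≤ n, SameT L (fun F => UP.mk (UU n k) F) (j k)
  compat : ∀ k < n, ∀ F, (Dep {0}ᶜ F ∨ Dep {k + 1}ᶜ F) → j k F = j (k + 1) F
  aut : ∀ k ≤ n, sg k ∈ autG L E
  act : ∀ k ≤ n, ∀ F, sg k (j k F) = j k (fun s => σ (F s))

theorem exists_conf {M : Type w} [L.Structure M] [Nonempty M]
    (hst : ∀ U : Ultrafilter (ℕ → ℕ), StableStr L (UP U M)) (σ : Equiv.Perm M)
    (hσ : Elem L σ) (n : ℕ) :
    ∃ (E : Type w) (_ : L.Structure E) (S : ℕ → Set E) (j : ℕ → ((ℕ → ℕ) → M) → E)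
      (sg : ℕ → Equiv.Perm E), Conf L σ n E S j sg := by
  classical
  obtain ⟨E0, _, _, j0, h1, h2⟩ := exists_conf0 hst n n le_rfl
  obtain ⟨E, _, S, f, hR, hf, hfS⟩ := exists_rich E0 (L := L)
  let j : ℕ → ((ℕ → ℕ) → M) → E := fun k F => f (j0 k F)
  have hlos : ∀ k ≤ n, SameT L (fun F => UP.mk (UU n k) F) (j k) :=
    fun k hk => (h1 k hk).trans (hf.same _)
  have hsg : ∀ k, ∃ τ : Equiv.Perm E, k ≤ n → τ ∈ autG L E ∧
      ∀ F, τ (j k F) = j k (fun s => σ (F s)) := by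
    intro k
    by_cases hk : k ≤ n
    · have hs : SameT L (fun F => j k F) (fun F => j k (fun s => σ (F s))) := by
        intro ψ
        rw [same_los (hlos k hk), same_los (hlos k hk)]
        refine Filter.eventually_congr (Filter.Eventually.of_forall fun s => ?_)
        exact (hσ.real ψ (fun F : (ℕ → ℕ) → M => F s)).symm
      obtain ⟨τ, hτ, hτ'⟩ := hR.homog 0 _ _ (fun F => hfS _) (fun F => hfS _) hs
      exact ⟨τ, fun _ => ⟨hτ, hτ'⟩⟩
    · exact ⟨1, fun h => absurd h hk⟩
  choose sg hsg using hsg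
  refine ⟨E, inferInstance, S, j, sg, hR, fun k _ F => hfS _, hlos, ?_, fun k hk => (hsg k hk).1,
    fun k hk => (hsg k hk).2⟩
  intro k hk F hF
  exact congrArg f (h2 k hk F hF)

section conf

variable {M : Type w} [L.Structure M] {σ : Equiv.Perm M} {n : ℕ} {E : Type w}
  [L.Structure E] {S : ℕ → Set E} {j : ℕ → ((ℕ → ℕ) → M) → E} {sg : ℕ → Equiv.Perm E}

theorem Conf.chain (hC : Conf L σ n E S j sg) {a b : ℕ} (hab : a ≤ b) (hb : b ≤ n)
    {F : (ℕ → ℕ) → M} (hF : ∀ k, a ≤ k → k < b → Dep {0}ᶜ F ∨ Dep {k + 1}ᶜ F) :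
    j a F = j b F := by
  induction b, hab using Nat.le_induction with
  | base => rfl
  | succ b hab ih =>
    rw [ih (by omega) (fun k h1 h2 => hF k h1 (by omega))]
    exact hC.compat b (by omega) F (hF b hab (by omega))

theorem Conf.eq_n (hC : Conf L σ n E S j sg) {k : ℕ} (hk : k ≤ n) {F : (ℕ → ℕ) → M} {i : ℕ}
    (hF : Dep {i} F ∨ Dep {0} F) : j k F = j n F := by
  refine hC.chain hk le_rfl fun m _ _ => ?_
  rcases hF with hF | hF
  · by_cases hi : i = 0
    · right
      exact hF.mono (by intro x hx; simp at hx ⊢; omega)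
    · left
      exact hF.mono (by intro x hx; simp at hx ⊢; omega)
  · right
    exact hF.mono (by intro x hx; simp at hx ⊢; omega)

theorem Conf.eq_hi (hC : Conf L σ n E S j sg) {k i : ℕ} (hik : i ≤ k) (hk : k ≤ n)
    {F : (ℕ → ℕ) → M} (hF : Dep {i, 0} F) : j k F = j n F := by
  refine hC.chain hk le_rfl fun m _ _ => Or.inr ?_
  exact hF.mono (by intro x hx; simp at hx ⊢; omega)

theorem Conf.eq_lo (hC : Conf L σ n E S j sg) {k i : ℕ} (hik : k < i) (hk : k ≤ n)
    {F : (ℕ → ℕ) → M} (hF : Dep {i, 0} F) : j 0 F = j k F := by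
  refine hC.chain (Nat.zero_le _) hk fun m _ _ => Or.inr ?_
  exact hF.mono (by intro x hx; simp at hx ⊢; omega)

theorem Conf.eq_x (hC : Conf L σ n E S j sg) {k : ℕ} (hk : k ≤ n)
    {F : (ℕ → ℕ) → M} (hF : Dep {0}ᶜ F) : j k F = j n F :=
  hC.chain hk le_rfl fun _ _ _ => Or.inl hF

theorem Conf.act_inv (hC : Conf L σ n E S j sg) {k : ℕ} (hk : k ≤ n) (F : (ℕ → ℕ) → M) :
    (sg k)⁻¹ (j k F) = j k (fun s => σ⁻¹ (F s)) := by
  rw [Equiv.Perm.inv_eq_iff_eq, hC.act k hk]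
  simp only [perm_apply_inv]

/-- the elementary twist -/
def gg (sg : ℕ → Equiv.Perm E) (k : ℕ) : Equiv.Perm E := (sg (k + 1))⁻¹ * sg k

theorem Conf.gg_aut (hC : Conf L σ n E S j sg) {k : ℕ} (hk : k < n) : gg sg k ∈ autG L E :=
  mul_mem (inv_mem (hC.aut _ hk)) (hC.aut _ hk.le)

theorem Conf.gg_fix (hC : Conf L σ n E S j sg) {k : ℕ} (hk : k < n) {F : (ℕ → ℕ) → M}
    (hF : Dep {0}ᶜ F ∨ Dep {k + 1}ᶜ F) : gg sg k (j k F) = j k F := by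
  unfold gg
  rw [Equiv.Perm.mul_apply, Equiv.Perm.inv_eq_iff_eq, hC.act k hk.le, hC.compat k hk F hF,
    hC.act (k + 1) hk]
  exact hC.compat k hk _ (hF.imp (fun h => h.map σ) (fun h => h.map σ))

open Classical in
/-- the twist at `k + 1`, if `k + 1 ∈ R` -/
noncomputable def eps (sg : ℕ → Equiv.Perm E) (R : Finset ℕ) (k : ℕ) : Equiv.Perm E :=
  if k + 1 ∈ R then gg sg k else 1

/-- the product of the twists -/
noncomputable def pr (sg : ℕ → Equiv.Perm E) (R : Finset ℕ) : ℕ → Equiv.Perm E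
  | 0 => 1
  | k + 1 => eps sg R k * pr sg R k

theorem Conf.eps_aut (hC : Conf L σ n E S j sg) (R : Finset ℕ) {k : ℕ} (hk : k < n) :
    eps sg R k ∈ autG L E := by
  unfold eps
  split_ifs
  · exact hC.gg_aut hk
  · exact one_mem _

theorem Conf.eps_fix (hC : Conf L σ n E S j sg) (R : Finset ℕ) {k : ℕ} (hk : k < n)
    {F : (ℕ → ℕ) → M} (hF : Dep {0}ᶜ F ∨ Dep {k + 1}ᶜ F) : eps sg R k (j k F) = j k F := by
  unfold eps
  split_ifs
  · exact hC.gg_fix hk hF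
  · rfl

theorem Conf.pr_aut (hC : Conf L σ n E S j sg) (R : Finset ℕ) {k : ℕ} (hk : k ≤ n) :
    pr sg R k ∈ autG L E := by
  induction k with
  | zero => exact one_mem _
  | succ k ih => exact mul_mem (hC.eps_aut R hk) (ih (by omega))

theorem Conf.pr_fix_x (hC : Conf L σ n E S j sg) (R : Finset ℕ) {k : ℕ} (hk : k ≤ n)
    {F : (ℕ → ℕ) → M} (hF : Dep {0}ᶜ F) : pr sg R k (j n F) = j n F := by
  induction k with
  | zero => rfl
  | succ k ih =>
    rw [pr, Equiv.Perm.mul_apply, ih (by omega), ← hC.eq_x (k := k) (by omega) hF]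
    exact hC.eps_fix R hk (Or.inl hF)

theorem Conf.pr_fix_lo (hC : Conf L σ n E S j sg) (R : Finset ℕ) {k i : ℕ} (hki : k < i)
    (hk : k ≤ n) {F : (ℕ → ℕ) → M} (hF : Dep {i, 0} F) : pr sg R k (j 0 F) = j 0 F := by
  induction k with
  | zero => rfl
  | succ k ih =>
    rw [pr, Equiv.Perm.mul_apply, ih (by omega) (by omega),
      hC.eq_lo (k := k) (by omega) (by omega) hF]
    refine hC.eps_fix R hk (Or.inr ?_)
    exact hF.mono (by intro x hx; simp at hx ⊢; omega)

theorem Conf.pr_split (hC : Conf L σ n E S j sg) (R : Finset ℕ) (i d : ℕ) (hd : i + d ≤ n) :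
    ∃ h ∈ autG L E, pr sg R (i + d) = h * pr sg R i ∧
      ∀ F, Dep {i, 0} F → h (j n F) = j n F := by
  induction d with
  | zero => exact ⟨1, one_mem _, by simp, fun _ _ => rfl⟩
  | succ d ih =>
    obtain ⟨h, h1, h2, h3⟩ := ih (by omega)
    refine ⟨eps sg R (i + d) * h, mul_mem (hC.eps_aut R (by omega)) h1, ?_, fun F hF => ?_⟩
    · rw [← add_assoc, pr, h2, mul_assoc]
    · rw [Equiv.Perm.mul_apply, h3 F hF, ← hC.eq_hi (k := i + d) (by omega) (by omega) hF]
      refine hC.eps_fix R (by omega) (Or.inr ?_)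
      exact hF.mono (by intro x hx; simp at hx ⊢; omega)

/-- the small set -/
def WW (n : ℕ) (j : ℕ → ((ℕ → ℕ) → M) → E) (i : ℕ) : Set E :=
  {e | ∃ F : (ℕ → ℕ) → M, (Dep {i} F ∨ Dep {0} F) ∧ e = j n F}

theorem Conf.sg_W (hC : Conf L σ n E S j sg) {k : ℕ} (hk : k ≤ n) (i : ℕ) (e : E) :
    sg k e ∈ WW n j i ↔ e ∈ WW n j i := by
  constructor
  · rintro ⟨F, hF, he⟩
    have hF' : Dep {i} (fun s => σ⁻¹ (F s)) ∨ Dep {0} (fun s => σ⁻¹ (F s)) :=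
      hF.imp (fun h => h.map _) (fun h => h.map _)
    refine ⟨fun s => σ⁻¹ (F s), hF', ?_⟩
    rw [← hC.eq_n hk hF', ← hC.act_inv hk, hC.eq_n hk hF, ← he, perm_inv_apply]
  · rintro ⟨F, hF, rfl⟩
    have hF' : Dep {i} (fun s => σ (F s)) ∨ Dep {0} (fun s => σ (F s)) :=
      hF.imp (fun h => h.map _) (fun h => h.map _)
    refine ⟨fun s => σ (F s), hF', ?_⟩
    rw [← hC.eq_n hk hF', ← hC.act k hk, hC.eq_n hk hF]

theorem fix_W {W : Set E} {h : Equiv.Perm E} (hh : ∀ e ∈ W, h e = e) (e : E) :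
    h e ∈ W ↔ e ∈ W :=
  ⟨fun he => by have := h.injective (hh _ he); rwa [this] at he, fun he => by rwa [hh e he]⟩

end conf

end PartG

/-! ### Part H: transfer of truth values -/

section PartH

open Filter Function

variable {L : Language.{u, v}}

theorem UP_sigma {I : Type*} (U : Ultrafilter I) {M : Type*} [(LPlus L).Structure M]
    (F : I → M) : sigmaMap L (UP U M) (UP.mk U F) = UP.mk U (fun s => sigmaMap L M (F s)) := by
  have := Ultraproduct.funMap_cast (L := LPlus L) (M := fun _ : I => M) (u := U) (sigmaSymb L)
    (fun _ => F)
  unfold sigmaMap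
  have e : ∀ x : UP U M, (![x] : Fin 1 → UP U M) = fun _ => x := fun x => by
    funext i; simp
  have e' : ∀ x : M, (![x] : Fin 1 → M) = fun _ => x := fun x => by
    funext i; simp
  simp only [e, e']
  exact this

theorem UP_expansion {I : Type*} (U : Ultrafilter I) {M : Type*} [L.Structure M]
    [(LPlus L).Structure M] [h : (LHom.sumInl : L →ᴸ LPlus L).IsExpansionOn M] :
    (LHom.sumInl : L →ᴸ LPlus L).IsExpansionOn (UP U M) where
  map_onFunction := by
    intro n F x
    choose y hy using fun i => UP.mk_surj U (x i)
    obtain rfl : (fun i => UP.mk U (y i)) = x := funext hy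
    have h1 := Ultraproduct.funMap_cast (L := LPlus L) (M := fun _ : I => M) (u := U)
      (LHom.sumInl.onFunction F) y
    have h2 := Ultraproduct.funMap_cast (L := L) (M := fun _ : I => M) (u := U) F y
    refine h1.trans (Eq.trans ?_ h2.symm)
    congr 1
    funext s
    exact h.map_onFunction F _
  map_onRelation := by
    intro n R x
    choose y hy using fun i => UP.mk_surj U (x i)
    obtain rfl : (fun i => UP.mk U (y i)) = x := funext hy
    have h1 := relMap_quotient_mk' (L := LPlus L) (s := (U : Filter I).productSetoid (fun _ => M))
      (LHom.sumInl.onRelation R) y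
    have h2 := relMap_quotient_mk' (L := L) (s := (U : Filter I).productSetoid (fun _ => M)) R y
    refine (propext h1).trans (Eq.trans ?_ (propext h2).symm)
    change (∀ᶠ s in (U : Filter I), RelMap (LHom.sumInl.onRelation R) fun i => y i s) =
      ∀ᶠ s in (U : Filter I), RelMap R fun i => y i s
    simp only [h.map_onRelation]

/-- embedding of an ultrapower -/
noncomputable def embUP {I : Type*} (U : Ultrafilter I) {M E : Type*} [L.Structure M]
    [(LPlus L).Structure M] [(LHom.sumInl : L →ᴸ LPlus L).IsExpansionOn M] [Nonempty M]
    [L.Structure E] {f : (I → M) → E} (h : SameT L (fun F => UP.mk U F) f) (τ : Equiv.Perm E)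
    (hτ : ∀ F, τ (f F) = f (fun s => sigmaMap L M (F s))) : UP U M ↪[LPlus L] WA τ :=
  mkEmb (X := UP U M) (Y := WA τ) (liftUP U f) (liftUP_elem h).inj
    (fun n F x => by
      have := (UP_expansion (L := L) U (M := M)).map_onFunction F x
      have e := (liftUP_elem h).funMap F x
      rw [← this] at e
      exact e)
    (fun n R x => by
      have := (UP_expansion (L := L) U (M := M)).map_onRelation R x
      have e := (liftUP_elem h).relMap R x
      rw [← this] at e
      exact e)
    (fun p => by
      obtain ⟨F, rfl⟩ := UP.mk_surj U p
      have e1 := liftUP_mk h F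
      have e2 := liftUP_mk h (fun s => sigmaMap L M (F s))
      rw [UP_sigma]
      refine e2.trans ((hτ F).symm.trans ?_)
      exact (congrArg τ e1).symm)

theorem embUP_mk {I : Type*} (U : Ultrafilter I) {M E : Type*} [L.Structure M]
    [(LPlus L).Structure M] [(LHom.sumInl : L →ᴸ LPlus L).IsExpansionOn M] [Nonempty M]
    [L.Structure E] {f : (I → M) → E} (h : SameT L (fun F => UP.mk U F) f) (τ : Equiv.Perm E)
    (hτ : ∀ F, τ (f F) = f (fun s => sigmaMap L M (F s))) (F : I → M) :
    embUP U h τ hτ (UP.mk U F) = f F := liftUP_mk h F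

theorem UP_model {L' : Language.{u, v}} {S : L'.Theory} {I : Type*} (U : Ultrafilter I)
    {M : Type*} [L'.Structure M] [Nonempty M] (h : M ⊨ S) : UP U M ⊨ S := by
  rw [Theory.model_iff] at h ⊢
  exact fun φ hφ => ((UP.diag_elem (L := L') U (E := M)).sentence φ).1 (h φ hφ)

/-- truth in a twisted structure of a formula over an embedded ultrapower -/
theorem Tr_UP {T : L.Theory} {Tmc : (LPlus L).Theory}
    (hmc : IsModelCompletion.{u, v, w} (Taut T) Tmc) {M : Type w} [L.Structure M]
    [(LPlus L).Structure M] [(LHom.sumInl : L →ᴸ LPlus L).IsExpansionOn M] [Nonempty M]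
    (hM : M ⊨ Tmc) {I : Type} (U : Ultrafilter I)
    {E : Type w} [L.Structure E] [Nonempty E] (hE : E ⊨ T) {f : (I → M) → E}
    (h : SameT L (fun F => UP.mk U F) f) (τ : Equiv.Perm E) (hτE : τ ∈ autG L E)
    (hτ : ∀ F, τ (f F) = f (fun s => sigmaMap L M (F s))) {γ : Type*}
    (χ : (LPlus L).Formula γ) (F : γ → I → M) :
    Tr Tmc (WA τ) χ (fun i => f (F i)) ↔ ∀ᶠ s in (U : Filter I), χ.Realize (fun i => F i s) := by
  have hU : UP U M ⊨ Tmc := UP_model U hM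
  have q := Tr_emb hmc (hU.mono hmc.1) (WA_model hE τ hτE) (embUP U h τ hτ) χ
    (fun i => UP.mk U (F i))
  have e : (fun i => embUP U h τ hτ (UP.mk U (F i))) = fun i => f (F i) :=
    funext fun i => embUP_mk U h τ hτ (F i)
  rw [e] at q
  exact q.symm.trans ((Tr_model hmc hU χ _).trans (los U χ F))

section conf

variable {M : Type w} [L.Structure M] [Nonempty M] {σ : Equiv.Perm M} {n : ℕ} {E : Type w}
  [L.Structure E] {S : ℕ → Set E} {j : ℕ → ((ℕ → ℕ) → M) → E} {sg : ℕ → Equiv.Perm E}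

open Classical in
/-- restriction to the coordinates in `C` -/
noncomputable def res (C : Set ℕ) (s : ℕ → ℕ) : ℕ → ℕ := fun i => if i ∈ C then s i else 0

theorem dep_res {M : Type*} (C : Set ℕ) (F : (ℕ → ℕ) → M) : Dep C (fun s => F (res C s)) := by
  intro s s' h
  have : res C s = res C s' := by
    funext i
    unfold res
    split_ifs with hi
    · exact h i hi
    · rfl
  simp only [this]

theorem res_dep {M : Type*} {C : Set ℕ} {F : (ℕ → ℕ) → M} (h : Dep C F) :
    (fun s => F (res C s)) = F := by
  funext s
  refine h _ _ fun c hc => ?_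
  simp [res, hc]

theorem Conf.star_aux (hC : Conf L σ n E S j sg) {k : ℕ} (hk : k ≤ n) (i : ℕ) :
    ∃ (P : Type w) (_ : L.Structure P) (_ : Nonempty P) (f : P → E), Elem L f ∧
      (∀ p, f p ∈ S 0) ∧ WW n j i ⊆ Set.range f ∧ ∀ p, ∃ F, Dep {i, 0} F ∧ f p = j k F := by
  have hs := same_map (hC.los k hk) (res {i, 0})
  refine ⟨UP ((UU n k).map (res {i, 0})) M, inferInstance, inferInstance,
    liftUP _ (fun F => j k (fun s => F (res {i, 0} s))), liftUP_elem hs, ?_, ?_, ?_⟩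
  · intro p
    exact hC.inS k hk _
  · rintro e ⟨F, hF, rfl⟩
    refine ⟨UP.mk _ F, ?_⟩
    rw [liftUP_mk hs, res_dep, hC.eq_n hk hF]
    rcases hF with hF | hF
    · exact hF.mono (by intro x hx; simp at hx ⊢; omega)
    · exact hF.mono (by intro x hx; simp at hx ⊢; omega)
  · intro p
    exact ⟨_, dep_res _ _, rfl⟩

variable {T : L.Theory} {Tmc : (LPlus L).Theory}

theorem Conf.star (hC : Conf L σ n E S j sg) (hmc : IsModelCompletion.{u, v, w} (Taut T) Tmc)
    (hE : StableStr L E) (hT : E ⊨ T) {k : ℕ} (hk : k ≤ n) (i : ℕ) (τ : Equiv.Perm E)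
    (hτ : τ ∈ autG L E) (hτW : ∀ e, τ e ∈ WW n j i ↔ e ∈ WW n j i)
    (g : Equiv.Perm E) (hgE : g ∈ autG L E) (hg : ∀ F, Dep {i, 0} F → g (j k F) = j k F)
    {γ : Type*} (χ : (LPlus L).Formula γ) (v : γ → E) (hv : ∀ i', v i' ∈ WW n j i) :
    Tr Tmc (WA (τ * g)) χ v ↔ Tr Tmc (WA τ) χ v := by
  obtain ⟨P, _, _, f, hf, hfS, hW, hr⟩ := hC.star_aux hk i
  refine star_Tr hmc hC.rich hE hT 0 f hf hfS _ hW τ hτ hτW g hgE (fun p => ?_) χ v hv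
  obtain ⟨F, hF, e⟩ := hr p
  rw [e, hg F hF]

theorem Conf.star_left (hC : Conf L σ n E S j sg)
    (hmc : IsModelCompletion.{u, v, w} (Taut T) Tmc)
    (hE : StableStr L E) (hT : E ⊨ T) {k : ℕ} (hk : k ≤ n) (i : ℕ) (τ : Equiv.Perm E)
    (hτ : τ ∈ autG L E) (hτW : ∀ e, τ e ∈ WW n j i ↔ e ∈ WW n j i)
    (g : Equiv.Perm E) (hgE : g ∈ autG L E) (hg : ∀ F, Dep {i, 0} F → g (j k F) = j k F)
    {γ : Type*} (χ : (LPlus L).Formula γ) (v : γ → E) (hv : ∀ i', v i' ∈ WW n j i) :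
    Tr Tmc (WA (g * τ)) χ v ↔ Tr Tmc (WA τ) χ v := by
  obtain ⟨P, _, _, f, hf, hfS, hW, hr⟩ := hC.star_aux hk i
  refine star_Tr_left hmc hC.rich hE hT 0 f hf hfS _ hW τ hτ hτW g hgE (fun p => ?_) χ v hv
  obtain ⟨F, hF, e⟩ := hr p
  rw [e, hg F hF]

/-- the key reduction -/
theorem Conf.key (hC : Conf L σ n E S j sg) (hmc : IsModelCompletion.{u, v, w} (Taut T) Tmc)
    (hE : StableStr L E) (hT : E ⊨ T) (R : Finset ℕ) (i : ℕ) (hi : i + 1 ≤ n)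
    {γ : Type*} (χ : (LPlus L).Formula γ) (v : γ → E) (hv : ∀ i', v i' ∈ WW n j (i + 1)) :
    Tr Tmc (WA (sg n * pr sg R n)) χ v ↔
      Tr Tmc (WA (sg (if i + 1 ∈ R then i else n))) χ v := by
  obtain ⟨h, hh, h1, h2⟩ := hC.pr_split R (i + 1) (n - (i + 1)) (by omega)
  rw [show i + 1 + (n - (i + 1)) = n by omega] at h1
  have hfW : ∀ e ∈ WW n j (i + 1), h e = e := by
    rintro e ⟨F, hF, rfl⟩
    refine h2 F ?_
    rcases hF with hF | hF
    · exact hF.mono (by intro x hx; simp at hx ⊢; omega)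
    · exact hF.mono (by intro x hx; simp at hx ⊢; omega)
  have heW : ∀ e ∈ WW n j (i + 1), eps sg R i e = e := by
    rintro e ⟨F, hF, rfl⟩
    rw [← hC.eq_n (k := i) (by omega) hF]
    refine hC.eps_fix R hi ?_
    rcases hF with hF | hF
    · exact Or.inl (hF.mono (by intro x hx; simp at hx ⊢; omega))
    · exact Or.inr (hF.mono (by intro x hx; simp at hx ⊢; omega))
  have hsn := hC.aut n le_rfl
  have hA := hC.star hmc hE hT (Nat.zero_le n) (i + 1) (sg n * (h * eps sg R i))
    (mul_mem hsn (mul_mem hh (hC.eps_aut R hi)))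
    (fun e => by
      rw [Equiv.Perm.mul_apply, Equiv.Perm.mul_apply, hC.sg_W le_rfl, fix_W hfW, fix_W heW])
    (pr sg R i) (hC.pr_aut R (by omega))
    (fun F hF => hC.pr_fix_lo R (Nat.lt_succ_self i) (by omega) hF) χ v hv
  have e1 : sg n * pr sg R n = sg n * (h * eps sg R i) * pr sg R i := by
    rw [h1, pr]
    simp only [mul_assoc]
  rw [e1]
  refine hA.trans ?_
  by_cases hiR : i + 1 ∈ R
  · have hc : ∀ F, Dep {i + 1, 0} F → (sg n * h * (sg (i + 1))⁻¹) (j n F) = j n F := by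
      intro F hF
      have hF' : Dep {i + 1, 0} (fun s => σ⁻¹ (F s)) := hF.map _
      rw [Equiv.Perm.mul_apply, Equiv.Perm.mul_apply, ← hC.eq_hi le_rfl hi hF, hC.act_inv hi,
        hC.eq_hi le_rfl hi hF', h2 _ hF', hC.act n le_rfl, hC.eq_hi le_rfl hi hF]
      simp only [perm_apply_inv]
    have hB := hC.star_left hmc hE hT (le_refl n) (i + 1) (sg i) (hC.aut i (by omega))
      (hC.sg_W (by omega) (i + 1)) (sg n * h * (sg (i + 1))⁻¹)
      (mul_mem (mul_mem hsn hh) (inv_mem (hC.aut _ hi))) hc χ v hv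
    have e2 : sg n * (h * eps sg R i) = sg n * h * (sg (i + 1))⁻¹ * sg i := by
      simp only [eps, hiR, if_true, gg, mul_assoc]
    rw [e2, if_pos hiR]
    exact hB
  · have hB := hC.star hmc hE hT (le_refl n) (i + 1) (sg n) hsn (hC.sg_W le_rfl (i + 1)) h hh
      h2 χ v hv
    have e2 : sg n * (h * eps sg R i) = sg n * h := by
      simp only [eps, hiR, if_false, mul_one]
    rw [e2, if_neg hiR]
    exact hB

end conf

end PartH

/-! ### Part I: conclusion -/

section PartI

open Filter Function

variable {L : Language.{u, v}}

open Classical in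
/-- the formula saying that some `b` realizes the pattern `R` -/
noncomputable def chi {L' : Language.{u, v}} {nx ny : ℕ} (φ : L'.Formula (Fin nx ⊕ Fin ny))
    (n : ℕ) (R : Finset ℕ) : L'.Formula (Fin n × Fin nx) :=
  Formula.iExs (Fin ny) (Formula.iInf (fun i : Fin n =>
    if (i : ℕ) + 1 ∈ R then ∼(φ.relabel (Sum.map (fun q => (i, q)) id))
      else φ.relabel (Sum.map (fun q => (i, q)) id)))

theorem realize_chi {L' : Language.{u, v}} {nx ny : ℕ} (φ : L'.Formula (Fin nx ⊕ Fin ny))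
    (n : ℕ) (R : Finset ℕ) {N : Type*} [L'.Structure N] (v : Fin n × Fin nx → N) :
    (chi φ n R).Realize v ↔ ∃ b : Fin ny → N, ∀ i : Fin n,
      φ.Realize (Sum.elim (fun q => v (i, q)) b) ↔ (i : ℕ) + 1 ∉ R := by
  classical
  unfold chi
  rw [Formula.realize_iExs]
  refine exists_congr fun b => ?_
  rw [Formula.realize_iInf]
  refine forall_congr' fun i => ?_
  have e : (Sum.elim v b ∘ Sum.map (fun q => (i, q)) id : Fin nx ⊕ Fin ny → N) =
      Sum.elim (fun q => v (i, q)) b := by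
    funext x; cases x <;> rfl
  split_ifs with h
  · rw [Formula.realize_not, Formula.realize_relabel, e]
    simp [h]
  · rw [Formula.realize_relabel, e]
    simp [h]

theorem stable_of {T : L.Theory} (hstable : IsStableTheory.{u, v, w} T) (E : Type w)
    [L.Structure E] [Nonempty E] (hE : E ⊨ T) : StableStr L E := by
  intro nx ny φ h
  obtain ⟨a, b, hab⟩ := h
  exact hstable ⟨nx, ny, φ, ⟨E⟩, a, b, hab⟩

theorem patterns {T : L.Theory} (hstable : IsStableTheory.{u, v, w} T)
    {Tmc : (LPlus L).Theory} (hmc : IsModelCompletion.{u, v, w} (Taut T) Tmc)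
    (M : Type w) [L.Structure M] [(LPlus L).Structure M]
    [(LHom.sumInl : L →ᴸ LPlus L).IsExpansionOn M] [Nonempty M] (hM : M ⊨ Tmc) {nx ny : ℕ}
    (φ : (LPlus L).Formula (Fin nx ⊕ Fin ny)) (a : ℕ → Fin nx → M) (b : ℕ → Fin ny → M)
    (hab : ∀ i j : ℕ, φ.Realize (Sum.elim (a i) (b j)) ↔ i < j) (n : ℕ) :
    ∃ a' : Fin n → Fin nx → M, ∀ R ⊆ Finset.range (n + 1), ∃ b' : Fin ny → M, ∀ i : Fin n,
      φ.Realize (Sum.elim (a' i) b') ↔ (i : ℕ) + 1 ∉ R := by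
  have hMaut : M ⊨ Taut T := hM.mono hmc.1
  have hMT := (models_Taut_iff T M).1 hMaut
  let σ : Equiv.Perm M := Equiv.ofBijective _ hMT.2.1
  have hσ : Elem L σ := sigma_elem T M hMaut
  have hst : ∀ U : Ultrafilter (ℕ → ℕ), StableStr L (UP U M) := fun U =>
    stable_of hstable _ (UP_model U hMT.1)
  obtain ⟨E, _, S, j, sg, hC⟩ := exists_conf hst σ hσ n
  haveI : Nonempty E := hC.rich.ne
  have hET : E ⊨ T := by
    have h0 : UP (UU n n) M ⊨ T := UP_model _ hMT.1
    rw [Theory.model_iff] at h0 ⊢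
    exact fun ψ hψ => ((liftUP_elem (hC.los n le_rfl)).sentence ψ).1 (h0 ψ hψ)
  have hE : StableStr L E := stable_of hstable E hET
  -- truth values
  let xx : ℕ → Fin nx → (ℕ → ℕ) → M := fun i q s => a (s i) q
  let yy : Fin ny → (ℕ → ℕ) → M := fun q s => b (s 0) q
  have dx : ∀ i q, Dep {i} (xx i q) := fun i q s s' h => by
    have := h i rfl
    simp only [xx, this]
  have dy : ∀ q, Dep {0} (yy q) := fun q s s' h => by
    have := h 0 rfl
    simp only [yy, this]
  have hval : ∀ (R : Finset ℕ) (i : ℕ), i + 1 ≤ n →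
      (Tr Tmc (WA (sg n * pr sg R n)) φ
        (fun p => j n (Sum.elim (xx (i + 1)) yy p)) ↔ i + 1 ∉ R) := by
    intro R i hi
    have hd : ∀ p, Dep {i + 1} (Sum.elim (xx (i + 1)) yy p) ∨
        Dep {0} (Sum.elim (xx (i + 1)) yy p) := by
      rintro (p | p)
      · exact Or.inl (dx _ _)
      · exact Or.inr (dy _)
    refine (hC.key hmc hE hET R i hi φ (fun p => j n (Sum.elim (xx (i + 1)) yy p))
      (fun p => ⟨_, hd p, rfl⟩)).trans ?_
    have hk : ∀ k ≤ n, (Tr Tmc (WA (sg k)) φ (fun p => j n (Sum.elim (xx (i + 1)) yy p)) ↔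
        ∀ᶠ s in (UU n k : Filter (ℕ → ℕ)), s (i + 1) < s 0) := by
      intro k hk
      have e : (fun p => j n (Sum.elim (xx (i + 1)) yy p)) =
          fun p => j k (Sum.elim (xx (i + 1)) yy p) :=
        funext fun p => (hC.eq_n hk (hd p)).symm
      rw [e]
      refine (Tr_UP hmc hM (UU n k) hET (hC.los k hk) (sg k) (hC.aut k hk) (hC.act k hk) φ
        (Sum.elim (xx (i + 1)) yy)).trans ?_
      refine Filter.eventually_congr (Filter.Eventually.of_forall fun s => ?_)
      rw [← hab]
      have : (fun p => Sum.elim (xx (i + 1)) yy p s) = Sum.elim (a (s (i + 1))) (b (s 0)) := by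
        funext p; cases p <;> rfl
      rw [this]
    by_cases hR : i + 1 ∈ R
    · rw [if_pos hR]
      refine (hk i (by omega)).trans ?_
      simp only [hR, not_true, iff_false]
      intro h
      have h' := UU_lt_of_gt (n := n) (Nat.lt_succ_self i) hi
      obtain ⟨s, h1, h2⟩ := (h.and h').exists
      exact absurd h1 (Nat.lt_asymm h2)
    · rw [if_neg hR]
      refine (hk n le_rfl).trans ?_
      simp only [hR, not_false_iff, iff_true]
      exact UU_lt_of_le (by omega) hi
  -- the patterns hold almost everywhere
  have hae : ∀ R : Finset ℕ, ∀ᶠ s in (UU n n : Filter (ℕ → ℕ)),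
      (chi φ n R).Realize (fun p : Fin n × Fin nx => a (s (p.1 + 1)) p.2) := by
    intro R
    have hτ : sg n * pr sg R n ∈ autG L E := mul_mem (hC.aut n le_rfl) (hC.pr_aut R le_rfl)
    have hTr : Tr Tmc (WA (sg n * pr sg R n)) (chi φ n R)
        (fun p : Fin n × Fin nx => j n (xx (p.1 + 1) p.2)) := by
      have hWA := WA_model hET _ hτ
      obtain ⟨N, ⟨e⟩⟩ := hmc.2.1 (Theory.ModelType.mk (WA (sg n * pr sg R n)))
      refine (Tr_iff hmc (WA_model hET _ hτ) N e (chi φ n R) _).2 ?_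
      rw [realize_chi]
      refine ⟨fun q => e (j n (yy q)), fun i => ?_⟩
      rw [← hval R i i.2]
      refine Iff.trans ?_ (Tr_iff hmc (WA_model hET _ hτ) N e φ _).symm
      have : (fun p => e (j n (Sum.elim (xx (i + 1)) yy p))) =
          Sum.elim (fun q => e (j n (xx (i + 1) q))) (fun q => e (j n (yy q))) := by
        funext p; cases p <;> rfl
      rw [this]
    have hx : ∀ i q, (fun s => xx (i + 1) q (res {0}ᶜ s)) = xx (i + 1) q := fun i q =>
      res_dep ((dx (i + 1) q).mono (by intro x hx; simp at hx ⊢; omega))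
    have := (Tr_UP hmc hM ((UU n n).map (res {0}ᶜ)) hET (same_map (hC.los n le_rfl) (res {0}ᶜ))
      (sg n * pr sg R n) hτ (fun F => by
        rw [Equiv.Perm.mul_apply, hC.pr_fix_x R le_rfl (dep_res _ F), hC.act n le_rfl]
        rfl) (chi φ n R) (fun p : Fin n × Fin nx => xx (p.1 + 1) p.2)).1
      (by simp only [hx]; exact hTr)
    rw [Ultrafilter.coe_map, Filter.eventually_map] at this
    refine this.mono fun s hs => ?_
    have e : (fun p : Fin n × Fin nx => xx (p.1 + 1) p.2 (res {0}ᶜ s)) =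
        fun p => a (s (p.1 + 1)) p.2 := by
      funext p
      exact congrFun (hx p.1 p.2) s
    rwa [e] at hs
  have hall : ∀ᶠ s in (UU n n : Filter (ℕ → ℕ)), ∀ R ∈ (Finset.range (n + 1)).powerset,
      (chi φ n R).Realize (fun p : Fin n × Fin nx => a (s (p.1 + 1)) p.2) :=
    (Filter.eventually_all_finset _).2 fun R _ => hae R
  obtain ⟨s, hs⟩ := hall.exists
  refine ⟨fun i => a (s (i + 1)), fun R hR => ?_⟩
  exact (realize_chi φ n R _).1 (hs R (Finset.mem_powerset.2 hR))

theorem ip_of_patterns {L' : Language.{u, v}} {Tstar : L'.Theory}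
    (M : Type w) [L'.Structure M] [Nonempty M] (hM : M ⊨ Tstar) {nx ny : ℕ}
    (φ : L'.Formula (Fin nx ⊕ Fin ny))
    (h : ∀ n : ℕ, ∃ a' : Fin n → Fin nx → M, ∀ R ⊆ Finset.range (n + 1), ∃ b' : Fin ny → M,
      ∀ i : Fin n, φ.Realize (Sum.elim (a' i) b') ↔ (i : ℕ) + 1 ∉ R) :
    HasIndependenceProperty.{u, v, w} Tstar := by
  classical
  choose a' ha' using h
  haveI := UP_model (hyperfilter ℕ) hM
  let d : Fin nx → M := fun _ => Classical.arbitrary M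
  let A : ℕ → ℕ → Fin nx → M := fun i n => if hi : i < n then a' n ⟨i, hi⟩ else d
  refine ⟨nx, ny, φ, ⟨UP (hyperfilter ℕ) M⟩,
    fun i q => UP.mk (hyperfilter ℕ) (fun n => A i n q), fun s => ?_⟩
  choose B hB using fun n => ha' n
    ((Finset.range (n + 1)).filter (fun k => k - 1 ∉ s)) (Finset.filter_subset _ _)
  refine ⟨fun q => UP.mk (hyperfilter ℕ) (fun n => B n q), fun i => ?_⟩
  have e : (Sum.elim (fun q => UP.mk (hyperfilter ℕ) (fun n => A i n q))
      (fun q => UP.mk (hyperfilter ℕ) (fun n => B n q)) : Fin nx ⊕ Fin ny → UP (hyperfilter ℕ) M) =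
      fun p => UP.mk (hyperfilter ℕ) (fun n => Sum.elim (A i n) (B n) p) := by
    funext p; cases p <;> rfl
  have h1 : ∀ᶠ n in (hyperfilter ℕ : Filter ℕ), (φ.Realize (Sum.elim (A i n) (B n)) ↔ i ∈ s) := by
    have h2 : ∀ᶠ n in (hyperfilter ℕ : Filter ℕ), i < n :=
      Nat.hyperfilter_le_atTop (eventually_gt_atTop i)
    refine h2.mono fun n hn => ?_
    have := hB n ⟨i, hn⟩
    simp only [A, dif_pos hn]
    rw [this]
    simp [hn]
  refine Iff.trans ?_ ((Filter.eventually_congr h1).trans (Filter.eventually_const))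
  rw [← los]
  exact iff_of_eq (congrArg _ e)

theorem op_of_ip {L' : Language.{u, v}} {S : L'.Theory}
    (h : HasIndependenceProperty.{u, v, w} S) : HasOrderProperty.{u, v, w} S := by
  obtain ⟨nx, ny, φ, N, a, h⟩ := h
  choose b hb using h
  exact ⟨nx, ny, φ, N, a, fun k => b (Finset.range k), fun i k => by rw [hb]; simp⟩

end PartI

theorem every_completion_stable_iff_every_completion_dependent
    (L : Language.{u, v}) (T : L.Theory) (hT : SemComplete T)
    (hstable : IsStableTheory.{u, v, w} T)
    (Tmc : (LPlus L).Theory)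
    (hmc : IsModelCompletion.{u, v, w} (Taut T) Tmc) :
    (∀ Tstar : (LPlus L).Theory, IsCompletionOf Tmc Tstar →
        IsStableTheory.{u, v, w} Tstar) ↔
      (∀ Tstar : (LPlus L).Theory, IsCompletionOf Tmc Tstar →
        IsDependentTheory.{u, v, w} Tstar) := by
  constructor
  · intro h Tstar hc hip
    exact h Tstar hc (op_of_ip hip)
  · intro h Tstar hc hop
    apply h Tstar hc
    obtain ⟨nx, ny, φ, N, a, b, hab⟩ := hop
    have hN : (N : Type w) ⊨ Tstar := N.is_model
    letI : L.Structure N := (LHom.sumInl : L →ᴸ LPlus L).reduct N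
    haveI : (LHom.sumInl : L →ᴸ LPlus L).IsExpansionOn N :=
      (LHom.sumInl : L →ᴸ LPlus L).isExpansionOn_reduct N
    exact ip_of_patterns N hN φ (patterns hstable hmc N (hN.mono hc.1) φ a b hab)

end ShelahE34

end FirstOrder
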